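/- Let p ∈ 𝒜 be non-negative and non-decreasing in time t for every fixed x, and let u be a weak solution of the linear auxiliary problem with precipitation function p. Then for every fixed x ∈ ℝ, the function t ↦ (u − ψ)(x, t) is non-increasing on [0, ∞). -/

import Mathlib

open MeasureTheory Filter Set

noncomputable section

/-- The precipitation-free self-similar solution `ψ(x,t)`. -/
def psi (α β x t : ℝ) : ℝ :=
  if 0 < t then
    (α * β / 2) * Real.exp (α ^ 2 / 4) *
      ∫ ζ in Set.Ioi (max (|x| / Real.sqrt t) α), Real.exp (-ζ ^ 2 / 4)
  else 0

/-- The profile `Ψ(η)` in similarity coordinates. -/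
def PsiP (α β η : ℝ) : ℝ :=
  (α * β / 2) * Real.exp (α ^ 2 / 4) * ∫ ζ in Set.Ioi (max η α), Real.exp (-ζ ^ 2 / 4)

/-- Regularity of a weak solution: `w` is the spatial derivative of `u - ψ`;
both are continuous on `ℝ × [0,∞)` and bounded on `ℝ × [0,T]` for every `T > 0`. -/
def AuxReg (α β : ℝ) (u w : ℝ → ℝ → ℝ) : Prop :=
  (∀ t ∈ Set.Ici (0:ℝ), ∀ x : ℝ, HasDerivAt (fun y => u y t - psi α β y t) (w x t) x) ∧
  ContinuousOn (fun q : ℝ × ℝ => u q.1 q.2 - psi α β q.1 q.2) (Set.univ ×ˢ Set.Ici 0) ∧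
  ContinuousOn (fun q : ℝ × ℝ => w q.1 q.2) (Set.univ ×ˢ Set.Ici 0) ∧
  ∀ T > (0:ℝ), ∃ C : ℝ, ∀ x : ℝ, ∀ t ∈ Set.Icc (0:ℝ) T,
    |u x t - psi α β x t| ≤ C ∧ |w x t| ≤ C

/-- A test function of class `C^{1,1}(ℝ × [0,T])`, vanishing for large `|x|` and at `t = T`,
together with its partial derivatives `φt`, `φx`. -/
def IsTestFun (T : ℝ) (φ φt φx : ℝ → ℝ → ℝ) : Prop :=
  (∀ x : ℝ, ∀ t ∈ Set.Icc (0:ℝ) T,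
    HasDerivWithinAt (fun s => φ x s) (φt x t) (Set.Icc 0 T) t) ∧
  (∀ x : ℝ, ∀ t ∈ Set.Icc (0:ℝ) T, HasDerivAt (fun y => φ y t) (φx x t) x) ∧
  ContinuousOn (fun q : ℝ × ℝ => φ q.1 q.2) (Set.univ ×ˢ Set.Icc 0 T) ∧
  ContinuousOn (fun q : ℝ × ℝ => φt q.1 q.2) (Set.univ ×ˢ Set.Icc 0 T) ∧
  ContinuousOn (fun q : ℝ × ℝ => φx q.1 q.2) (Set.univ ×ˢ Set.Icc 0 T) ∧
  (∃ R : ℝ, ∀ x : ℝ, ∀ t ∈ Set.Icc (0:ℝ) T, R ≤ |x| → φ x t = 0) ∧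
  (∀ x : ℝ, φ x T = 0)

/-- The weak form of the equation, relative to a given precipitation function `p` and
the spatial derivative `w` of `u - ψ`. -/
def WeakForm (α β : ℝ) (u p w : ℝ → ℝ → ℝ) : Prop :=
  ∀ T > (0:ℝ), ∀ φ φt φx : ℝ → ℝ → ℝ, IsTestFun T φ φt φx →
    (∫ t in Set.Ioc (0:ℝ) T, ∫ x : ℝ, φt x t * (u x t - psi α β x t))
      = ∫ t in Set.Ioc (0:ℝ) T, ∫ x : ℝ, (φx x t * w x t + p x t * u x t * φ x t)

/-- A weak solution of the linear auxiliary problem with given precipitation function `p`. -/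
def IsAuxSolution (α β : ℝ) (p u : ℝ → ℝ → ℝ) : Prop :=
  (∀ x t : ℝ, u (-x) t = u x t) ∧
  ∃ w : ℝ → ℝ → ℝ, AuxReg α β u w ∧ WeakForm α β u p w

/-- A weak solution `(u, p)` of the HHMO model. -/
def IsWeakSolution (α β ustar : ℝ) (u p : ℝ → ℝ → ℝ) : Prop :=
  (∀ x t : ℝ, u (-x) t = u x t) ∧
  (∀ x t : ℝ, p (-x) t = p x t) ∧
  Measurable (fun q : ℝ × ℝ => p q.1 q.2) ∧
  (∀ x : ℝ, ∀ t ∈ Set.Ici (0:ℝ),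
    (sSup ((fun s => u x s) '' Set.Icc 0 t) < ustar → p x t = 0) ∧
    (sSup ((fun s => u x s) '' Set.Icc 0 t) = ustar → p x t ∈ Set.Icc (0:ℝ) 1) ∧
    (ustar < sSup ((fun s => u x s) '' Set.Icc 0 t) → p x t = 1)) ∧
  (∀ x : ℝ, MonotoneOn (fun t => p x t) (Set.Ici (0:ℝ))) ∧
  ∃ w : ℝ → ℝ → ℝ, AuxReg α β u w ∧ WeakForm α β u p w

/-- Condition (P): the precipitation function depends only on `x` beyond the parabola
`t = x²/α²`. -/
def CondP (α : ℝ) (p : ℝ → ℝ → ℝ) (pstar : ℝ → ℝ) : Prop :=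
  Measurable pstar ∧
  ∀ᵐ x ∂(volume.restrict (Set.Ioi (0:ℝ))), ∀ t : ℝ, x ^ 2 / α ^ 2 < t → p x t = pstar x

/-- The admissible class `𝒜` of precipitation functions. -/
def IsAdmissible (p : ℝ → ℝ → ℝ) : Prop :=
  (∀ x t : ℝ, p (-x) t = p x t) ∧
  MeasureTheory.LocallyIntegrableOn (fun q : ℝ × ℝ => p q.1 q.2) (Set.Ioi 0 ×ˢ Set.Ici 0) ∧
  ∀ T > (0:ℝ), ∃ R : ℝ, ∀ x ≥ R, ∀ t ∈ Set.Icc (0:ℝ) T, p x t = 0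

/-- `u` converges uniformly, in parabolic similarity coordinates, to the profile `Φ`. -/
def ConvUnif (u : ℝ → ℝ → ℝ) (Φ : ℝ → ℝ) : Prop :=
  ∀ ε > (0:ℝ), ∃ T : ℝ, ∀ t ≥ T, ∀ η ≥ (0:ℝ), |u (η * Real.sqrt t) t - Φ η| < ε

/-- The error function. -/
def erf (x : ℝ) : ℝ := (2 / Real.sqrt Real.pi) * ∫ s in (0:ℝ)..x, Real.exp (-s ^ 2)

/-- The complementary error function. -/
def erfc (x : ℝ) : ℝ := (2 / Real.sqrt Real.pi) * ∫ s in Set.Ioi x, Real.exp (-s ^ 2)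

/-- Kummer's confluent hypergeometric function `M(a,b,z)` (real arguments). -/
def kummerM (a b z : ℝ) : ℝ :=
  ∑' n : ℕ, (Polynomial.eval a (ascPochhammer ℝ n) / Polynomial.eval b (ascPochhammer ℝ n))
    * z ^ n / (n.factorial : ℝ)

/-- `κ = (1 + √(4γ+1))/2`, the positive root of `κ(κ-1) = γ`. -/
def kappaOf (γ : ℝ) : ℝ := (1 + Real.sqrt (4 * γ + 1)) / 2

/-- The value `u*_γ` determined by the derivative matching condition. -/
def ustarGamma (α β γ : ℝ) : ℝ :=
  (α * β / 2) *
    (kappaOf γ * kummerM (kappaOf γ / 2 + 1) (kappaOf γ + 1 / 2) (-α ^ 2 / 4) /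
        (α * kummerM (kappaOf γ / 2) (kappaOf γ + 1 / 2) (-α ^ 2 / 4)) +
      Real.exp (-α ^ 2 / 4) / (Real.sqrt Real.pi * erfc (α / 2)))⁻¹

/-- The self-similar profile `Φ_γ`. -/
def Phi (α β γ η : ℝ) : ℝ :=
  if η < α then
    ustarGamma α β γ * η ^ kappaOf γ *
      kummerM (kappaOf γ / 2) (kappaOf γ + 1 / 2) (-η ^ 2 / 4) /
      (α ^ kappaOf γ * kummerM (kappaOf γ / 2) (kappaOf γ + 1 / 2) (-α ^ 2 / 4))
  else ustarGamma α β γ * erfc (η / 2) / erfc (α / 2)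

open scoped Topology ContDiff Convolution

/-- `D` is a viscosity subsolution of the heat equation at `(x₀, t₀)`, tested against
polynomials `c₁ x + c₂ x² + c₃ t` touching from above in the past of `t₀`. -/
def HeatViscAt (D : ℝ → ℝ → ℝ) (x₀ t₀ : ℝ) : Prop :=
  ∀ c₁ c₂ c₃ : ℝ,
    (∀ᶠ z in 𝓝 x₀ ×ˢ 𝓝[≤] t₀, D z.1 z.2 - (c₁ * z.1 + c₂ * z.1 ^ 2 + c₃ * z.2) ≤
      D x₀ t₀ - (c₁ * x₀ + c₂ * x₀ ^ 2 + c₃ * t₀)) → c₃ ≤ 2 * c₂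

lemma HasDerivAt.nonpos_of_eventually_right_le {g : ℝ → ℝ} {g' x : ℝ} (h : HasDerivAt g g' x)
    (hle : ∀ᶠ y in 𝓝[>] x, g y ≤ g x) : g' ≤ 0 := by
  have h1 := (hasDerivWithinAt_iff_tendsto_slope' (by simp)).1 (h.hasDerivWithinAt (s := Ioi x))
  refine le_of_tendsto h1 ?_
  filter_upwards [hle, self_mem_nhdsWithin] with y hy hxy
  rw [slope_def_field]
  exact div_nonpos_of_nonpos_of_nonneg (by linarith) (sub_nonneg.2 (le_of_lt hxy))

lemma HasDerivAt.nonneg_of_eventually_left_le {g : ℝ → ℝ} {g' x : ℝ} (h : HasDerivAt g g' x)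
    (hle : ∀ᶠ y in 𝓝[<] x, g y ≤ g x) : 0 ≤ g' := by
  have h1 := (hasDerivWithinAt_iff_tendsto_slope' (by simp)).1 (h.hasDerivWithinAt (s := Iio x))
  refine ge_of_tendsto h1 ?_
  filter_upwards [hle, self_mem_nhdsWithin] with y hy hxy
  rw [slope_def_field]
  exact div_nonneg_of_nonpos (by linarith) (sub_nonpos.2 (le_of_lt hxy))

/-- Maximum principle on the half-line with a Neumann condition at the origin. -/
lemma nonpos_of_heatViscAt {D : ℝ → ℝ → ℝ} {T C : ℝ}
    (husc : UpperSemicontinuousOn (fun q : ℝ × ℝ => D q.1 q.2) (Ici 0 ×ˢ Icc 0 T))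
    (hbd : ∀ x ≥ 0, ∀ t ∈ Icc 0 T, D x t ≤ C)
    (hinit : ∀ x ≥ 0, D x 0 ≤ 0)
    (hneumann : ∀ t ∈ Ioc 0 T, HasDerivAt (fun x => D x t) 0 0)
    (hvisc : ∀ x > 0, ∀ t ∈ Ioc 0 T, 0 < D x t → HeatViscAt D x t) :
    ∀ x ≥ 0, ∀ t ∈ Icc 0 T, D x t ≤ 0 := by
  intro x₁ hx₁ t₁ ht₁
  by_contra! hpos
  set A := D x₁ t₁ with hA
  have hden : 0 < 2 * (x₁ ^ 2 + 3 * t₁ + 1) := by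
    have := ht₁.1
    positivity
  set ε := A / (2 * (x₁ ^ 2 + 3 * t₁ + 1)) with hε
  have hε0 : 0 < ε := div_pos hpos hden
  have hεA : ε * (2 * (x₁ ^ 2 + 3 * t₁ + 1)) = A := div_mul_cancel₀ _ hden.ne'
  set R := |C| / ε + 1 + x₁ with hR
  have hR1 : 1 ≤ R := by
    have : 0 ≤ |C| / ε := by positivity
    linarith
  have hRC : C ≤ ε * (R ^ 2 - R) := by
    have h1 : |C| = ε * (|C| / ε) := by field_simp
    have h2 : |C| / ε ≤ R - 1 := by linarith
    have h0 : 0 ≤ |C| / ε := by positivity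
    have h3 : |C| / ε ≤ R ^ 2 - R := by nlinarith
    calc C ≤ |C| := le_abs_self C
      _ = ε * (|C| / ε) := h1
      _ ≤ _ := by gcongr
  let E : ℝ × ℝ → ℝ := fun q => D q.1 q.2 + ε * (q.1 - q.1 ^ 2 - 3 * q.2)
  have hEusc : UpperSemicontinuousOn E (Icc 0 R ×ˢ Icc 0 T) := by
    refine UpperSemicontinuousOn.add (husc.mono ?_) ?_
    · exact prod_mono Icc_subset_Ici_self le_rfl
    · exact (Continuous.upperSemicontinuous (by fun_prop)).upperSemicontinuousOn _
  have hmem : (x₁, t₁) ∈ Icc 0 R ×ˢ Icc 0 T := by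
    refine ⟨⟨hx₁, ?_⟩, ht₁⟩
    have : 0 ≤ |C| / ε := by positivity
    simp only
    linarith
  obtain ⟨⟨x₀, t₀⟩, ⟨hx₀, ht₀⟩, hmax⟩ := UpperSemicontinuousOn.exists_isMaxOn ⟨_, hmem⟩
    (isCompact_Icc.prod isCompact_Icc) hEusc
  simp only at hx₀ ht₀
  have hmax' : ∀ x ∈ Icc 0 R, ∀ t ∈ Icc 0 T,
      D x t + ε * (x - x ^ 2 - 3 * t) ≤ D x₀ t₀ + ε * (x₀ - x₀ ^ 2 - 3 * t₀) :=
    fun x hx t ht => hmax (show (x, t) ∈ Icc 0 R ×ˢ Icc 0 T from ⟨hx, ht⟩)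
  have hbig : ε < D x₀ t₀ + ε * (x₀ - x₀ ^ 2 - 3 * t₀) := by
    refine lt_of_lt_of_le ?_ (hmax' x₁ hmem.1 t₁ ht₁)
    rw [← hA]
    have := ht₁.1
    have h3 : 0 ≤ ε * x₁ := by positivity
    nlinarith [mul_pos hε0 hε0, mul_nonneg hε0.le (sq_nonneg x₁), mul_nonneg hε0.le this]
  have hquarter : ∀ x : ℝ, ε * (x - x ^ 2) ≤ ε / 4 := fun x => by
    nlinarith [mul_nonneg hε0.le (sq_nonneg (x - 1 / 2))]
  have ht₀pos : 0 < t₀ := by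
    rcases ht₀.1.eq_or_lt with h | h
    · subst h
      have := hinit x₀ hx₀.1
      have := hquarter x₀
      nlinarith
    · exact h
  have hεt : 0 < ε * t₀ := mul_pos hε0 ht₀pos
  have hx₀pos : 0 < x₀ := by
    rcases hx₀.1.eq_or_lt with h | h
    · subst h
      exfalso
      have hd : HasDerivAt (fun x => D x t₀ + ε * (x - x ^ 2 - 3 * t₀)) ε 0 := by
        have h1 : HasDerivAt (fun x : ℝ => x - x ^ 2 - 3 * t₀) 1 0 := by
          have := (((hasDerivAt_id (0:ℝ)).sub (hasDerivAt_pow 2 (0:ℝ))).sub_const (3 * t₀))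
          simpa using this
        exact ((hneumann t₀ ⟨ht₀pos, ht₀.2⟩).fun_add (h1.const_mul ε)).congr_deriv (by ring)
      refine absurd (hd.nonpos_of_eventually_right_le ?_) (not_le.2 hε0)
      have : Ioo 0 R ∈ 𝓝[>] (0:ℝ) := Ioo_mem_nhdsGT (by linarith)
      filter_upwards [this] with x hx
      exact hmax' x ⟨hx.1.le, hx.2.le⟩ t₀ ht₀
    · exact h
  have hx₀R : x₀ < R := by
    rcases hx₀.2.eq_or_lt with h | h
    · exfalso
      have := hbd x₀ hx₀.1 t₀ ht₀
      rw [← h] at hRC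
      nlinarith
    · exact h
  have hDpos : 0 < D x₀ t₀ := by
    have := hquarter x₀
    nlinarith
  have := hvisc x₀ hx₀pos t₀ ⟨ht₀pos, ht₀.2⟩ hDpos (-ε) ε (3 * ε) ?_
  · linarith
  · have h1 : Ioo 0 R ∈ 𝓝 x₀ := Ioo_mem_nhds hx₀pos hx₀R
    have h2 : Ioc 0 t₀ ∈ 𝓝[≤] t₀ := Ioc_mem_nhdsLE ht₀pos
    filter_upwards [prod_mem_prod h1 h2] with z hz
    have := hmax' z.1 ⟨hz.1.1.le, hz.1.2.le⟩ z.2 ⟨hz.2.1.le, hz.2.2.trans ht₀.2⟩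
    linarith

lemma continuous_integral_mul_of_hasCompactSupport {X : Type*} [TopologicalSpace X]
    [FirstCountableTopology X] [LocallyCompactSpace X] {ξ : ℝ → ℝ} (hξ : Continuous ξ)
    (hc : HasCompactSupport ξ) {g : X → ℝ → ℝ} (hg : Continuous fun q : X × ℝ => g q.1 q.2) :
    Continuous fun z => ∫ y, ξ y * g z y := by
  have h1 : Continuous fun z => ∫ y in tsupport ξ, ξ y * g z y :=
    continuous_parametric_integral_of_continuous (f := fun z y => ξ y * g z y)
      ((hξ.comp continuous_snd).mul hg) hc
  convert h1 using 2 with z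
  refine (setIntegral_eq_integral_of_forall_compl_eq_zero fun y hy => ?_).symm
  rw [image_eq_zero_of_notMem_tsupport hy, zero_mul]

lemma IsLocalMax.deriv_deriv_nonpos {g : ℝ → ℝ} {x : ℝ} (h : IsLocalMax g x)
    (hc : ContinuousAt g x) : deriv (deriv g) x ≤ 0 := by
  by_contra! hpos
  have hmin := isLocalMin_of_deriv_deriv_pos hpos h.deriv_eq_zero hc
  have hconst : g =ᶠ[𝓝 x] fun _ => g x := by
    filter_upwards [h, hmin] with y h1 h2 using le_antisymm h1 h2
  have := hconst.deriv.deriv_eq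
  simp at this
  linarith

lemma heat_le_of_strict_max {V : ℝ → ℝ → ℝ} (hV : Continuous fun q : ℝ × ℝ => V q.1 q.2)
    {x₀ t₀ r δ c₁ c₂ c₃ : ℝ} (hr : 0 < r) (hδ : 0 < δ)
    (hweak : ∀ ξ : ℝ → ℝ, ContDiff ℝ ∞ ξ → HasCompactSupport ξ →
      tsupport ξ ⊆ Ioo (x₀ - r) (x₀ + r) → (∀ x, 0 ≤ ξ x) →
      ∀ s t, t₀ - r ≤ s → s ≤ t → t ≤ t₀ →
      (∫ x, ξ x * V x t) - (∫ x, ξ x * V x s) ≤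
        ∫ τ in s..t, ∫ x, deriv (deriv ξ) x * V x τ)
    (hmax : ∀ x ∈ Icc (x₀ - r) (x₀ + r), ∀ t ∈ Icc (t₀ - r) t₀,
      V x t - (c₁ * x + c₂ * x ^ 2 + c₃ * t) ≤
        V x₀ t₀ - (c₁ * x₀ + c₂ * x₀ ^ 2 + c₃ * t₀) - δ * ((x - x₀) ^ 2 + (t₀ - t))) :
    c₃ ≤ 2 * c₂ := by
  by_contra! hlt
  set m := min (r ^ 2 / 4) r with hm
  have hm0 : 0 < m := lt_min (by positivity) hr
  set η := δ * m / 4 with hη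
  have hη0 : 0 < η := by positivity
  have hcpt : IsCompact (Icc (x₀ - r) (x₀ + r) ×ˢ Icc (t₀ - r) t₀) :=
    isCompact_Icc.prod isCompact_Icc
  obtain ⟨κ, hκ0, hκ⟩ := Metric.uniformContinuousOn_iff_le.1
    (hcpt.uniformContinuousOn_of_continuous hV.continuousOn) η hη0
  have hk0 : 0 < min κ (r / 2) := lt_min hκ0 (by positivity)
  let b : ContDiffBump (0 : ℝ) := ⟨min κ (r / 2) / 4, min κ (r / 2) / 2, by positivity, by linarith⟩
  have hb1 : b.rOut < κ := by
    have : b.rOut = min κ (r / 2) / 2 := rfl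
    linarith [min_le_left κ (r / 2)]
  have hb2 : b.rOut < r / 2 := by
    have : b.rOut = min κ (r / 2) / 2 := rfl
    linarith [min_le_right κ (r / 2)]
  set ρ := b.normed volume with hρ
  have hρs : ContDiff ℝ ∞ ρ := b.contDiff_normed
  have hρc : HasCompactSupport ρ := b.hasCompactSupport_normed
  have hρ's : ContDiff ℝ ∞ (deriv ρ) := ((contDiff_infty_iff_deriv).1 hρs).2
  have hρ''s : ContDiff ℝ ∞ (deriv (deriv ρ)) := ((contDiff_infty_iff_deriv).1 hρ's).2
  let cv : (ℝ → ℝ) → ℝ → ℝ → ℝ := fun f t x => ∫ y, f y * V (x - y) t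
  have hcv : ∀ f t, cv f t = f ⋆[ContinuousLinearMap.lsmul ℝ ℝ, volume] (fun x => V x t) := by
    intro f t
    ext x
    rw [convolution_lsmul]
    simp [cv]
  have hVt : ∀ t, Continuous fun x => V x t := fun t =>
    hV.comp (continuous_id.prodMk continuous_const)
  have hcvc : ∀ f, Continuous f → HasCompactSupport f →
      Continuous fun z : ℝ × ℝ => cv f z.2 z.1 := by
    intro f hf hfc
    refine continuous_integral_mul_of_hasCompactSupport hf hfc
      (g := fun (z : ℝ × ℝ) y => V (z.1 - y) z.2) ?_
    exact hV.comp ((continuous_fst.fst.sub continuous_snd).prodMk continuous_fst.snd)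
  have hcvd : ∀ f, ContDiff ℝ ∞ f → HasCompactSupport f → ∀ t x,
      HasDerivAt (cv f t) (cv (deriv f) t x) x := by
    intro f hf hfc t x
    rw [hcv, hcv]
    exact hfc.hasDerivAt_convolution_left _ (hf.of_le (by norm_cast))
      (hVt t).locallyIntegrable x
  have hclose : ∀ x ∈ Icc (x₀ - r / 2) (x₀ + r / 2), ∀ t ∈ Icc (t₀ - r) t₀,
      |cv ρ t x - V x t| ≤ η := by
    intro x hx t ht
    rw [hcv, ← Real.dist_eq]
    refine b.dist_normed_convolution_le (hVt t).aestronglyMeasurable fun y hy => ?_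
    have hy' : |y - x| < b.rOut := by simpa [Real.dist_eq] using hy
    have hyl := abs_lt.1 hy'
    refine hκ (y, t) ⟨⟨?_, ?_⟩, ht⟩ (x, t) ⟨⟨?_, ?_⟩, ht⟩ ?_
    · simp only; linarith [hx.1]
    · simp only; linarith [hx.2]
    · simp only; linarith [hx.1]
    · simp only; linarith [hx.2]
    · rw [dist_prod_same_right, Real.dist_eq]
      exact (hy'.trans hb1).le
  have hcvint : ∀ f x t, cv f t x = ∫ y, f (x - y) * V y t := by
    intro f x t
    rw [hcv, convolution_eq_swap]
    simp
  have htime : ∀ x ∈ Icc (x₀ - r / 2) (x₀ + r / 2), ∀ s t, t₀ - r ≤ s → s ≤ t → t ≤ t₀ →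
      cv ρ t x - cv ρ s x ≤ ∫ τ in s..t, cv (deriv (deriv ρ)) τ x := by
    intro x hx s t hs hst ht
    have h := hweak (fun y => ρ (x - y)) (hρs.comp (contDiff_const.sub contDiff_id))
      (hρc.comp_homeomorph (Homeomorph.subLeft x)) ?_ (fun y => b.nonneg_normed _) s t hs hst ht
    · have hd : deriv (deriv fun y => ρ (x - y)) = fun y => deriv (deriv ρ) (x - y) := by
        have h1 : (deriv fun y => ρ (x - y)) = fun y => -deriv ρ (x - y) := by
          ext y; exact deriv_comp_const_sub ..
        rw [h1]
        ext y
        rw [deriv.fun_neg, deriv_comp_const_sub, neg_neg]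
      rw [hd] at h
      simpa only [hcvint] using h
    · have hcl : tsupport (fun y => ρ (x - y)) ⊆ Metric.closedBall x b.rOut := by
        refine closure_minimal (fun y hy => ?_) Metric.isClosed_closedBall
        have : x - y ∈ Function.support ρ := hy
        rw [b.support_normed_eq] at this
        have h2 : |x - y| < b.rOut := by simpa using this
        rw [Metric.mem_closedBall, dist_comm, Real.dist_eq]
        exact h2.le
      refine hcl.trans fun y hy => ?_
      rw [Metric.mem_closedBall, Real.dist_eq] at hy
      have := abs_le.1 hy
      constructor <;> linarith [hx.1, hx.2]
  obtain ⟨⟨xk, tk⟩, ⟨hxk, htk⟩, hmaxk⟩ :=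
    (isCompact_Icc.prod isCompact_Icc :
      IsCompact (Icc (x₀ - r / 2) (x₀ + r / 2) ×ˢ Icc (t₀ - r) t₀)).exists_isMaxOn
      ⟨(x₀, t₀), ⟨by constructor <;> simp <;> linarith, by constructor <;> (simp; try linarith)⟩⟩
      (f := fun z : ℝ × ℝ => cv ρ z.2 z.1 - (c₁ * z.1 + c₂ * z.1 ^ 2 + c₃ * z.2))
      (((hcvc ρ hρs.continuous hρc).sub (by fun_prop)).continuousOn)
  simp only at hxk htk
  have hmaxk' : ∀ x ∈ Icc (x₀ - r / 2) (x₀ + r / 2), ∀ t ∈ Icc (t₀ - r) t₀,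
      cv ρ t x - (c₁ * x + c₂ * x ^ 2 + c₃ * t) ≤
        cv ρ tk xk - (c₁ * xk + c₂ * xk ^ 2 + c₃ * tk) := fun x hx t ht =>
    hmaxk (show (x, t) ∈ Icc (x₀ - r / 2) (x₀ + r / 2) ×ˢ Icc (t₀ - r) t₀ from ⟨hx, ht⟩)
  have hx₀m : x₀ ∈ Icc (x₀ - r / 2) (x₀ + r / 2) := by constructor <;> linarith
  have ht₀m : t₀ ∈ Icc (t₀ - r) t₀ := by constructor <;> linarith
  have hdist : (xk - x₀) ^ 2 + (t₀ - tk) ≤ m / 2 := by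
    have h1 := hmaxk' x₀ hx₀m t₀ ht₀m
    have h2 := (abs_le.1 (hclose x₀ hx₀m t₀ ht₀m)).1
    have h3 := (abs_le.1 (hclose xk hxk tk htk)).2
    have h4 := hmax xk ⟨by linarith [hxk.1], by linarith [hxk.2]⟩ tk htk
    have h5 : δ * ((xk - x₀) ^ 2 + (t₀ - tk)) ≤ δ * (m / 2) := by linarith
    exact le_of_mul_le_mul_left h5 hδ
  have hxk' : |xk - x₀| < r / 2 := by
    refine abs_lt_of_sq_lt_sq ?_ (by positivity)
    have := min_le_left (r ^ 2 / 4) r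
    nlinarith [htk.2]
  have htk' : t₀ - r < tk := by
    have := min_le_right (r ^ 2 / 4) r
    nlinarith [sq_nonneg (xk - x₀)]
  have hxkl := abs_lt.1 hxk'
  have hspace : cv (deriv (deriv ρ)) tk xk ≤ 2 * c₂ := by
    have hd1 : ∀ x, HasDerivAt (fun x => cv ρ tk x - (c₁ * x + c₂ * x ^ 2 + c₃ * tk))
        (cv (deriv ρ) tk x - (c₁ + c₂ * (2 * x))) x := by
      intro x
      refine (hcvd ρ hρs hρc tk x).fun_sub ?_
      refine HasDerivAt.add_const _ ?_
      have h2 := (hasDerivAt_pow 2 x).const_mul c₂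
      have h1 := (hasDerivAt_id x).const_mul c₁
      exact (h1.fun_add h2).congr_deriv (by simp)
    have hd2 : HasDerivAt (fun x => cv (deriv ρ) tk x - (c₁ + c₂ * (2 * x)))
        (cv (deriv (deriv ρ)) tk xk - 2 * c₂) xk := by
      refine (hcvd (deriv ρ) hρ's hρc.deriv tk xk).fun_sub ?_
      exact ((((hasDerivAt_id xk).const_mul 2).const_mul c₂).const_add c₁).congr_deriv
        (by simp; ring)
    have hloc : IsLocalMax (fun x => cv ρ tk x - (c₁ * x + c₂ * x ^ 2 + c₃ * tk)) xk := by
      have : Ioo (x₀ - r / 2) (x₀ + r / 2) ∈ 𝓝 xk :=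
        Ioo_mem_nhds (by linarith [hxkl.1]) (by linarith [hxkl.2])
      filter_upwards [this] with x hx
      exact hmaxk' x ⟨hx.1.le, hx.2.le⟩ tk htk
    have := hloc.deriv_deriv_nonpos (hd1 xk).continuousAt
    rw [show deriv (fun x => cv ρ tk x - (c₁ * x + c₂ * x ^ 2 + c₃ * tk)) = _ from
      funext fun x => (hd1 x).deriv, hd2.deriv] at this
    linarith
  have hcont : Continuous fun τ => cv (deriv (deriv ρ)) τ xk :=
    (hcvc _ hρ''s.continuous hρc.deriv.deriv).comp (continuous_const.prodMk continuous_id)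
  set c := cv (deriv (deriv ρ)) tk xk with hc
  have hnear : ∀ᶠ τ in 𝓝 tk, cv (deriv (deriv ρ)) τ xk < (2 * c₂ + c₃) / 2 :=
    hcont.continuousAt.eventually_lt continuousAt_const (by linarith)
  obtain ⟨θ, hθ0, hθ⟩ := Metric.eventually_nhds_iff.1 hnear
  set s := max (tk - θ / 2) (t₀ - r) with hs
  have hstk : s < tk := max_lt (by linarith) htk'
  have h1 := htime xk hxk s tk (le_max_right _ _) hstk.le htk.2
  have h2 := hmaxk' xk hxk s ⟨le_max_right _ _, hstk.le.trans htk.2⟩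
  have h3 : ∫ τ in s..tk, cv (deriv (deriv ρ)) τ xk ≤ ∫ _τ in s..tk, (2 * c₂ + c₃) / 2 := by
    refine intervalIntegral.integral_mono_on hstk.le (hcont.intervalIntegrable _ _)
      (by simp) fun τ hτ => (hθ ?_).le
    rw [Real.dist_eq, abs_lt]
    have := le_max_left (tk - θ / 2) (t₀ - r)
    constructor <;> linarith [hτ.1, hτ.2]
  rw [intervalIntegral.integral_const, smul_eq_mul] at h3
  nlinarith

/-- A continuous function which is a weak subsolution of the heat equation in a backward
parabolic neighbourhood of a point is a viscosity subsolution there. -/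
lemma heatViscAt_of_weak {V : ℝ → ℝ → ℝ} {x₀ t₀ r : ℝ} (hr : 0 < r)
    (hV : ContinuousOn (fun q : ℝ × ℝ => V q.1 q.2) (Icc (x₀ - r) (x₀ + r) ×ˢ Icc (t₀ - r) t₀))
    (hweak : ∀ ξ : ℝ → ℝ, ContDiff ℝ ∞ ξ → HasCompactSupport ξ →
      tsupport ξ ⊆ Ioo (x₀ - r) (x₀ + r) → (∀ x, 0 ≤ ξ x) →
      ∀ s t, t₀ - r ≤ s → s ≤ t → t ≤ t₀ →
      (∫ x, ξ x * V x t) - (∫ x, ξ x * V x s) ≤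
        ∫ τ in s..t, ∫ x, deriv (deriv ξ) x * V x τ) :
    HeatViscAt V x₀ t₀ := by
  intro c₁ c₂ c₃ hev
  obtain ⟨P, hP, Q, hQ, hPQ⟩ := eventually_prod_iff.1 hev
  obtain ⟨a, ha, hPa⟩ := Metric.eventually_nhds_iff.1 hP
  obtain ⟨l, hl, hQl⟩ := (mem_nhdsLE_iff_exists_Ioc_subset).1 hQ
  have hl' : l < t₀ := hl
  set r' := min r (min (a / 2) ((t₀ - l) / 2)) with hr'
  have hr'0 : 0 < r' := lt_min hr (lt_min (by positivity) (by linarith))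
  have hr'r : r' ≤ r := min_le_left _ _
  have hr'a : r' ≤ a / 2 := (min_le_right _ _).trans (min_le_left _ _)
  have hr'l : r' ≤ (t₀ - l) / 2 := (min_le_right _ _).trans (min_le_right _ _)
  let px : ℝ → ℝ := fun x => max (x₀ - r) (min (x₀ + r) x)
  let pt : ℝ → ℝ := fun t => max (t₀ - r) (min t₀ t)
  have hpx : ∀ x ∈ Icc (x₀ - r) (x₀ + r), px x = x := fun x hx => by
    simp only [px]; rw [min_eq_right hx.2, max_eq_right hx.1]
  have hpt : ∀ t ∈ Icc (t₀ - r) t₀, pt t = t := fun t ht => by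
    simp only [pt]; rw [min_eq_right ht.2, max_eq_right ht.1]
  let U : ℝ → ℝ → ℝ := fun x t => V (px x) (pt t)
  have hU : Continuous fun q : ℝ × ℝ => U q.1 q.2 := by
    refine hV.comp_continuous (f := fun q : ℝ × ℝ => (px q.1, pt q.2)) (by fun_prop) fun q => ?_
    refine ⟨⟨le_max_left _ _, max_le (by linarith) (min_le_left _ _)⟩,
      ⟨le_max_left _ _, max_le (by linarith) (min_le_left _ _)⟩⟩
  have hUV : ∀ x ∈ Icc (x₀ - r) (x₀ + r), ∀ t ∈ Icc (t₀ - r) t₀, U x t = V x t := by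
    intro x hx t ht
    simp only [U, hpx x hx, hpt t ht]
  have hx₀m : x₀ ∈ Icc (x₀ - r) (x₀ + r) := by constructor <;> linarith
  have ht₀m : t₀ ∈ Icc (t₀ - r) t₀ := by constructor <;> linarith
  have key : ∀ δ > 0, c₃ - δ ≤ 2 * (c₂ + δ) := by
    intro δ hδ
    refine heat_le_of_strict_max (x₀ := x₀) (t₀ := t₀) (c₁ := c₁ - 2 * δ * x₀) hU hr'0 hδ ?_ ?_
    · intro ξ hξ hξc hsupp hξ0 s t hs hst ht
      have hloc : ∀ f : ℝ → ℝ, tsupport f ⊆ tsupport ξ → ∀ τ ∈ Icc (t₀ - r) t₀,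
          ∫ x, f x * U x τ = ∫ x, f x * V x τ := by
        intro f hf τ hτ
        refine integral_congr_ae (Eventually.of_forall fun x => ?_)
        by_cases hx : x ∈ tsupport f
        · have hx' := hsupp (hf hx)
          simp only
          rw [hUV x ⟨by linarith [hx'.1], by linarith [hx'.2]⟩ τ hτ]
        · simp [image_eq_zero_of_notMem_tsupport hx]
      have hdd : tsupport (deriv (deriv ξ)) ⊆ tsupport ξ :=
        (tsupport_deriv_subset).trans (tsupport_deriv_subset)
      rw [hloc ξ le_rfl t ⟨by linarith, ht⟩, hloc ξ le_rfl s ⟨by linarith, by linarith⟩]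
      refine (hweak ξ hξ hξc (hsupp.trans (Ioo_subset_Ioo (by linarith) (by linarith))) hξ0 s t
        (by linarith) hst ht).trans_eq ?_
      refine intervalIntegral.integral_congr fun τ hτ => ?_
      rw [uIcc_of_le hst] at hτ
      exact (hloc _ hdd τ ⟨by linarith [hτ.1], by linarith [hτ.2]⟩).symm
    · intro x hx t ht
      rw [hUV x ⟨by linarith [hx.1], by linarith [hx.2]⟩ t ⟨by linarith [ht.1], ht.2⟩,
        hUV x₀ hx₀m t₀ ht₀m]
      have h1 : P x := hPa (by
        rw [Real.dist_eq, abs_lt]; constructor <;> linarith [hx.1, hx.2])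
      have h2 : Q t := hQl ⟨by linarith [ht.1], ht.2⟩
      have := hPQ h1 h2
      simp only at this
      linarith
  refine le_of_forall_pos_le_add fun ε hε => ?_
  have := key (ε / 3) (by positivity)
  linarith

lemma continuousOn_integral_mul_slice {v : ℝ → ℝ → ℝ}
    (hv : ContinuousOn (fun q : ℝ × ℝ => v q.1 q.2) (univ ×ˢ Ici 0)) {ξ : ℝ → ℝ}
    (hξ : Continuous ξ) (hc : HasCompactSupport ξ) :
    ContinuousOn (fun t => ∫ x, ξ x * v x t) (Ici 0) := by
  have h : Continuous fun t => ∫ x, ξ x * v x (max 0 t) := by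
    refine continuous_integral_mul_of_hasCompactSupport hξ hc (g := fun t x => v x (max 0 t)) ?_
    exact hv.comp_continuous (f := fun q : ℝ × ℝ => (q.2, max 0 q.1)) (by fun_prop)
      fun q => ⟨mem_univ _, show (0:ℝ) ≤ max 0 q.1 from le_max_left _ _⟩
  refine h.continuousOn.congr fun t ht => ?_
  simp only [max_eq_right (show (0:ℝ) ≤ t from ht)]

/-- Fundamental lemma of the calculus of variations in time: if `∫ θ' a = ∫ θ c` for all `C¹`
functions `θ` vanishing at `T`, then `a` is minus the primitive of `c` vanishing at `0`. -/
lemma eq_neg_primitive_of_forall_integral_eq {a c : ℝ → ℝ} {T : ℝ} (hT : 0 < T)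
    (ha : ContinuousOn a (Icc 0 T)) (hc : IntervalIntegrable c volume 0 T)
    (h : ∀ θ g : ℝ → ℝ, Continuous g → (∀ t, HasDerivAt θ (g t) t) → θ T = 0 →
      ∫ t in 0..T, g t * a t = ∫ t in 0..T, θ t * c t) :
    ∀ t ∈ Icc 0 T, a t = -∫ τ in 0..t, c τ := by
  set B : ℝ → ℝ := fun t => ∫ τ in 0..t, c τ with hB
  have hBac : AbsolutelyContinuousOnInterval B 0 T :=
    hc.absolutelyContinuousOnInterval_intervalIntegral (by simp)
  have hBc : ContinuousOn B (Icc 0 T) := by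
    have := hBac.continuousOn
    rwa [uIcc_of_le hT.le] at this
  have hsum : ContinuousOn (fun t => a t + B t) (Icc 0 T) := ha.add hBc
  let g : ℝ → ℝ := fun t => a (max 0 (min T t)) + B (max 0 (min T t))
  have hgc : Continuous g := hsum.comp_continuous (f := fun t => max 0 (min T t)) (by fun_prop)
    fun t => ⟨le_max_left _ _, max_le hT.le (min_le_left _ _)⟩
  have hgeq : ∀ t ∈ Icc 0 T, g t = a t + B t := fun t ht => by
    simp only [g]; rw [min_eq_right ht.2, max_eq_right ht.1]
  let θ : ℝ → ℝ := fun t => ∫ τ in T..t, g τ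
  have hθd : ∀ t, HasDerivAt θ (g t) t := fun t =>
    intervalIntegral.integral_hasDerivAt_right (hgc.intervalIntegrable _ _)
      hgc.stronglyMeasurable.stronglyMeasurableAtFilter hgc.continuousAt
  have hθT : θ T = 0 := intervalIntegral.integral_same
  have hθ' : deriv θ = g := funext fun t => (hθd t).deriv
  have hθac : AbsolutelyContinuousOnInterval θ 0 T := by
    refine ContDiffOn.absolutelyContinuousOnInterval (ContDiff.contDiffOn ?_)
    exact contDiff_one_iff_deriv.2 ⟨fun t => (hθd t).differentiableAt, hθ' ▸ hgc⟩
  have hparts := hθac.integral_mul_deriv_eq_deriv_mul hBac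
  have hB0 : B 0 = 0 := intervalIntegral.integral_same
  rw [hθT, hB0, hθ', zero_mul, mul_zero, sub_zero, zero_sub] at hparts
  have hderivB : ∫ t in 0..T, θ t * deriv B t = ∫ t in 0..T, θ t * c t := by
    refine intervalIntegral.integral_congr_ae ?_
    filter_upwards [hc.ae_hasDerivAt_integral] with t ht htm
    rw [(ht (uIoc_subset_uIcc htm) 0 (by simp)).deriv]
  have hga := h θ g hgc hθd hθT
  have hgB : IntervalIntegrable (fun t => g t * B t) volume 0 T :=
    (hgc.continuousOn.mul hBac.continuousOn).intervalIntegrable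
  have hgai : IntervalIntegrable (fun t => g t * a t) volume 0 T :=
    (hgc.continuousOn.mul (by rwa [uIcc_of_le hT.le])).intervalIntegrable
  have hzero : ∫ t in 0..T, (a t + B t) ^ 2 = 0 := by
    have : ∫ t in 0..T, (a t + B t) ^ 2 = ∫ t in 0..T, (g t * a t + g t * B t) := by
      refine intervalIntegral.integral_congr fun t ht => ?_
      rw [uIcc_of_le hT.le] at ht
      simp only [hgeq t ht]
      ring
    rw [this, intervalIntegral.integral_add hgai hgB, hga, ← hderivB, hparts]
    ring
  intro t ht
  by_contra hne
  have hne' : a t + B t ≠ 0 := fun h0 => hne (by linarith)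
  have := intervalIntegral.integral_pos (f := fun t => (a t + B t) ^ 2) hT (hsum.pow 2)
    (fun s _ => sq_nonneg _) ⟨t, ht, sq_pos_of_ne_zero hne'⟩
  linarith

/-- A weak solution of `v_t = v_xx - f`, `v(·, 0) = 0`, integrated in time against a
time-independent test function. -/
lemma weak_integrated_in_time {v w f : ℝ → ℝ → ℝ} {T : ℝ} (hT : 0 < T)
    (hv : ContinuousOn (fun q : ℝ × ℝ => v q.1 q.2) (univ ×ˢ Ici 0))
    (hw : ContinuousOn (fun q : ℝ × ℝ => w q.1 q.2) (univ ×ˢ Ici 0))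
    (hder : ∀ t ∈ Ici (0:ℝ), ∀ x, HasDerivAt (fun y => v y t) (w x t) x)
    (hweak : ∀ φ φt φx : ℝ → ℝ → ℝ, IsTestFun T φ φt φx →
      (∫ t in Ioc (0:ℝ) T, ∫ x : ℝ, φt x t * v x t)
        = ∫ t in Ioc (0:ℝ) T, ∫ x : ℝ, (φx x t * w x t + f x t * φ x t))
    {ξ : ℝ → ℝ} (hξ : ContDiff ℝ ∞ ξ) (hξc : HasCompactSupport ξ)
    (hf : IntegrableOn (fun q : ℝ × ℝ => f q.1 q.2 * ξ q.1) (univ ×ˢ Ioc 0 T)) :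
    (∀ᵐ τ ∂(volume.restrict (Ioc 0 T)), Integrable fun x => f x τ * ξ x) ∧
    IntervalIntegrable (fun τ => ∫ x, f x τ * ξ x) volume 0 T ∧
    ∀ t ∈ Icc 0 T, ∫ x, ξ x * v x t =
      (∫ τ in 0..t, ∫ x, deriv (deriv ξ) x * v x τ) - ∫ τ in 0..t, ∫ x, f x τ * ξ x := by
  have hξ' : ContDiff ℝ ∞ (deriv ξ) := ((contDiff_infty_iff_deriv).1 hξ).2
  have hξ'' : ContDiff ℝ ∞ (deriv (deriv ξ)) := ((contDiff_infty_iff_deriv).1 hξ').2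
  have hξd : ∀ x, HasDerivAt ξ (deriv ξ x) x := fun x =>
    (hξ.differentiable (by simp) x).hasDerivAt
  have hξ'd : ∀ x, HasDerivAt (deriv ξ) (deriv (deriv ξ) x) x := fun x =>
    (hξ'.differentiable (by simp) x).hasDerivAt
  rw [IntegrableOn, Measure.volume_eq_prod, ← Measure.prod_restrict, Measure.restrict_univ] at hf
  have hslice := hf.prod_left_ae
  have hN : IntervalIntegrable (fun τ => ∫ x, f x τ * ξ x) volume 0 T := by
    rw [intervalIntegrable_iff_integrableOn_Ioc_of_le hT.le]
    exact hf.integral_prod_right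
  refine ⟨hslice, hN, ?_⟩
  set N : ℝ → ℝ := fun τ => ∫ x, f x τ * ξ x
  set J : ℝ → ℝ := fun τ => ∫ x, deriv (deriv ξ) x * v x τ with hJ
  have hJc : ContinuousOn J (Ici 0) :=
    continuousOn_integral_mul_slice hv hξ''.continuous hξc.deriv.deriv
  have hJi : ∀ t ≥ 0, IntervalIntegrable J volume 0 t := fun t ht =>
    (hJc.mono (by rw [uIcc_of_le ht]; exact Icc_subset_Ici_self)).intervalIntegrable
  have hvt : ∀ t ∈ Ici (0:ℝ), Continuous fun x => v x t := fun t ht =>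
    hv.comp_continuous (by fun_prop : Continuous fun x : ℝ => (x, t)) fun x => ⟨mem_univ _, ht⟩
  have hwt : ∀ t ∈ Ici (0:ℝ), Continuous fun x => w x t := fun t ht =>
    hw.comp_continuous (by fun_prop : Continuous fun x : ℝ => (x, t)) fun x => ⟨mem_univ _, ht⟩
  have hξ'w : ∀ t ∈ Ici (0:ℝ), Integrable fun x => deriv ξ x * w x t := fun t ht =>
    (hξ'.continuous.mul (hwt t ht)).integrable_of_hasCompactSupport hξc.deriv.mul_right
  have hIBP : ∀ t ∈ Ici (0:ℝ), ∫ x, deriv ξ x * w x t = -J t := by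
    intro t ht
    refine integral_mul_deriv_eq_deriv_mul_of_integrable (fun x _ => hξ'd x)
      (fun x _ => hder t ht x) (hξ'w t ht) ?_ ?_
    · exact (hξ''.continuous.mul (hvt t ht)).integrable_of_hasCompactSupport
        hξc.deriv.deriv.mul_right
    · exact (hξ'.continuous.mul (hvt t ht)).integrable_of_hasCompactSupport hξc.deriv.mul_right
  have hcint : IntervalIntegrable (fun τ => -J τ + N τ) volume 0 T := (hJi T hT.le).neg.add hN
  have hac : ContinuousOn (fun t => ∫ x, ξ x * v x t) (Icc 0 T) :=
    (continuousOn_integral_mul_slice hv hξ.continuous hξc).mono Icc_subset_Ici_self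
  have key := eq_neg_primitive_of_forall_integral_eq hT hac hcint ?_
  · intro t ht
    have hNt : IntervalIntegrable N volume 0 t :=
      hN.mono_set (by rw [uIcc_of_le ht.1, uIcc_of_le hT.le]; exact Icc_subset_Icc_right ht.2)
    rw [key t ht, show (fun τ => -J τ + N τ) = fun τ => N τ - J τ from
      funext fun τ => neg_add_eq_sub _ _, intervalIntegral.integral_sub hNt (hJi t ht.1)]
    ring
  · intro θ g hg hθ hθT
    have hθc : Continuous θ := continuous_iff_continuousAt.2 fun t => (hθ t).continuousAt
    have h := hweak (fun x t => ξ x * θ t) (fun x t => ξ x * g t) (fun x t => deriv ξ x * θ t) ?_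
    · rw [intervalIntegral.integral_of_le hT.le, intervalIntegral.integral_of_le hT.le]
      convert h using 1
      · refine integral_congr_ae (Eventually.of_forall fun t => ?_)
        simp only
        rw [← integral_const_mul]
        congr 1
        ext x
        ring
      · refine integral_congr_ae ?_
        filter_upwards [hslice, ae_restrict_mem measurableSet_Ioc] with t hti htm
        have h0 : t ∈ Ici (0:ℝ) := htm.1.le
        rw [← hIBP t h0, ← integral_add (hξ'w t h0) hti, ← integral_const_mul]
        congr 1
        ext x
        ring
    · refine ⟨fun x t _ => ((hθ t).const_mul (ξ x)).hasDerivWithinAt,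
        fun x t _ => (hξd x).mul_const (θ t), ?_, ?_, ?_, ?_, fun x => by simp [hθT]⟩
      · have := hξ.continuous; exact Continuous.continuousOn (by fun_prop)
      · have := hξ.continuous; exact Continuous.continuousOn (by fun_prop)
      · have := hξ'.continuous; exact Continuous.continuousOn (by fun_prop)
      · obtain ⟨R, -, hR⟩ := hξc.exists_pos_le_norm
        exact ⟨R, fun x t _ hx => by simp [hR x hx]⟩

lemma integrable_exp_neg_sq_div_four : Integrable fun ζ : ℝ => Real.exp (-ζ ^ 2 / 4) := by
  convert integrable_exp_neg_mul_sq (b := 1 / 4) (by norm_num) using 3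
  ring

lemma hasDerivAt_integral_Ioi_exp (z : ℝ) :
    HasDerivAt (fun z => ∫ ζ in Ioi z, Real.exp (-ζ ^ 2 / 4)) (-Real.exp (-z ^ 2 / 4)) z := by
  have hcont : Continuous fun ζ : ℝ => Real.exp (-ζ ^ 2 / 4) := by fun_prop
  have h : (fun z => ∫ ζ in Ioi z, Real.exp (-ζ ^ 2 / 4)) =
      fun z => (∫ ζ in Ioi 0, Real.exp (-ζ ^ 2 / 4)) - ∫ ζ in (0:ℝ)..z, Real.exp (-ζ ^ 2 / 4) := by
    ext z
    rw [← intervalIntegral.integral_Ioi_sub_Ioi'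
      integrable_exp_neg_sq_div_four.integrableOn integrable_exp_neg_sq_div_four.integrableOn]
    ring
  rw [h]
  exact (intervalIntegral.integral_hasDerivAt_right (hcont.intervalIntegrable _ _)
    hcont.stronglyMeasurable.stronglyMeasurableAtFilter hcont.continuousAt).const_sub _

lemma antitone_integral_Ioi_exp : Antitone fun z : ℝ => ∫ ζ in Ioi z, Real.exp (-ζ ^ 2 / 4) :=
  antitone_of_deriv_nonpos (fun z => (hasDerivAt_integral_Ioi_exp z).differentiableAt) fun z => by
    rw [(hasDerivAt_integral_Ioi_exp z).deriv]
    exact neg_nonpos.2 (Real.exp_pos _).le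

lemma integral_Ioi_exp_nonneg (z : ℝ) : 0 ≤ ∫ ζ in Ioi z, Real.exp (-ζ ^ 2 / 4) :=
  integral_nonneg fun _ => (Real.exp_pos _).le

lemma psi_of_pos (α β x : ℝ) {t : ℝ} (ht : 0 < t) : psi α β x t = PsiP α β (|x| / √t) := by
  rw [psi, if_pos ht, PsiP]

lemma psi_of_nonpos (α β x : ℝ) {t : ℝ} (ht : t ≤ 0) : psi α β x t = 0 := by
  rw [psi, if_neg ht.not_gt]

lemma psi_neg_left (α β x t : ℝ) : psi α β (-x) t = psi α β x t := by
  simp only [psi, abs_neg]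

lemma psi_factor_pos {α β : ℝ} (hα : 0 < α) (hβ : 0 < β) :
    0 < α * β / 2 * Real.exp (α ^ 2 / 4) := by positivity

lemma continuous_PsiP (α β : ℝ) : Continuous (PsiP α β) := by
  have h : Continuous fun z : ℝ => ∫ ζ in Ioi z, Real.exp (-ζ ^ 2 / 4) :=
    continuous_iff_continuousAt.2 fun z => (hasDerivAt_integral_Ioi_exp z).continuousAt
  exact continuous_const.mul (h.comp (continuous_id.max continuous_const))

lemma antitone_PsiP {α β : ℝ} (hα : 0 < α) (hβ : 0 < β) : Antitone (PsiP α β) := fun _ _ h =>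
  mul_le_mul_of_nonneg_left (antitone_integral_Ioi_exp (max_le_max_right α h))
    (psi_factor_pos hα hβ).le

lemma PsiP_nonneg {α β : ℝ} (hα : 0 < α) (hβ : 0 < β) (η : ℝ) : 0 ≤ PsiP α β η :=
  mul_nonneg (psi_factor_pos hα hβ).le (integral_Ioi_exp_nonneg _)

lemma PsiP_of_le {α β η : ℝ} (h : η ≤ α) : PsiP α β η = PsiP α β α := by
  rw [PsiP, PsiP, max_eq_right h, max_self]

lemma psi_nonneg {α β : ℝ} (hα : 0 < α) (hβ : 0 < β) (x t : ℝ) : 0 ≤ psi α β x t := by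
  rcases lt_or_ge 0 t with ht | ht
  · rw [psi_of_pos _ _ _ ht]; exact PsiP_nonneg hα hβ _
  · rw [psi_of_nonpos _ _ _ ht]

lemma psi_le {α β : ℝ} (hα : 0 < α) (hβ : 0 < β) (x t : ℝ) : psi α β x t ≤ PsiP α β 0 := by
  rcases lt_or_ge 0 t with ht | ht
  · rw [psi_of_pos _ _ _ ht]; exact antitone_PsiP hα hβ (by positivity)
  · rw [psi_of_nonpos _ _ _ ht]; exact PsiP_nonneg hα hβ _

lemma psi_mono_right {α β : ℝ} (hα : 0 < α) (hβ : 0 < β) (x : ℝ) : Monotone (psi α β x) := by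
  intro s t hst
  rcases lt_or_ge 0 s with hs | hs
  · rw [psi_of_pos _ _ _ hs, psi_of_pos _ _ _ (hs.trans_le hst)]
    exact antitone_PsiP hα hβ (by gcongr)
  · rw [psi_of_nonpos _ _ _ hs]; exact psi_nonneg hα hβ _ _

lemma continuousOn_psi (α β : ℝ) :
    ContinuousOn (fun q : ℝ × ℝ => psi α β q.1 q.2) (univ ×ˢ Ioi 0) := by
  have h : ContinuousOn (fun q : ℝ × ℝ => PsiP α β (|q.1| / √q.2)) (univ ×ˢ Ioi 0) := by
    refine (continuous_PsiP α β).comp_continuousOn (ContinuousOn.div (by fun_prop) (by fun_prop) ?_)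
    exact fun q hq => (Real.sqrt_pos.2 hq.2).ne'
  exact h.congr fun q hq => psi_of_pos _ _ _ hq.2

lemma psi_of_le {α β x t : ℝ} (ht : 0 < t) (hx : |x| ≤ α * √t) : psi α β x t = PsiP α β α := by
  rw [psi_of_pos _ _ _ ht, PsiP_of_le]
  rwa [div_le_iff₀ (Real.sqrt_pos.2 ht)]

/-- The smooth solution of the heat equation that agrees with `ψ` for `x ≥ α √t`. -/
def psiOuter (α β x t : ℝ) : ℝ :=
  α * β / 2 * Real.exp (α ^ 2 / 4) * ∫ ζ in Ioi (x / √t), Real.exp (-ζ ^ 2 / 4)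

lemma psi_of_ge {α β x t : ℝ} (hα : 0 < α) (ht : 0 < t) (hx : α * √t ≤ x) :
    psi α β x t = psiOuter α β x t := by
  have hx0 : 0 ≤ x := le_trans (by positivity) hx
  rw [psi_of_pos _ _ _ ht, PsiP, psiOuter, abs_of_nonneg hx0, max_eq_left]
  rwa [le_div_iff₀ (Real.sqrt_pos.2 ht)]

lemma hasDerivAt_psiOuter_left (α β x : ℝ) {t : ℝ} (ht : 0 < t) :
    HasDerivAt (fun y => psiOuter α β y t)
      (-(α * β / 2 * Real.exp (α ^ 2 / 4) / √t) * Real.exp (-x ^ 2 / (4 * t))) x := by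
  have h := ((hasDerivAt_integral_Ioi_exp (x / √t)).comp x
    ((hasDerivAt_id x).div_const (√t))).const_mul (α * β / 2 * Real.exp (α ^ 2 / 4))
  refine h.congr_deriv ?_
  rw [show -(x / √t) ^ 2 / 4 = -x ^ 2 / (4 * t) by
    rw [div_pow, Real.sq_sqrt ht.le]; field_simp]
  ring

lemma hasDerivAt_psiOuter_right (α β x : ℝ) {t : ℝ} (ht : 0 < t) :
    HasDerivAt (fun s => psiOuter α β x s)
      (α * β / 2 * Real.exp (α ^ 2 / 4) / √t * Real.exp (-x ^ 2 / (4 * t)) * (x / (2 * t))) t := by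
  have hs := Real.sqrt_pos.2 ht
  have h := ((hasDerivAt_integral_Ioi_exp (x / √t)).comp t
    ((hasDerivAt_const t x).fun_div (Real.hasDerivAt_sqrt ht.ne') hs.ne')).const_mul
      (α * β / 2 * Real.exp (α ^ 2 / 4))
  refine h.congr_deriv ?_
  rw [show -(x / √t) ^ 2 / 4 = -x ^ 2 / (4 * t) by
    rw [div_pow, Real.sq_sqrt ht.le]; field_simp]
  rw [Real.sq_sqrt ht.le]
  field_simp
  ring

lemma deriv_deriv_psiOuter (α β x : ℝ) {t : ℝ} (ht : 0 < t) :
    HasDerivAt (deriv fun y => psiOuter α β y t)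
      (α * β / 2 * Real.exp (α ^ 2 / 4) / √t * Real.exp (-x ^ 2 / (4 * t)) * (x / (2 * t))) x := by
  rw [show (deriv fun y => psiOuter α β y t) = fun y =>
    -(α * β / 2 * Real.exp (α ^ 2 / 4) / √t) * Real.exp (-y ^ 2 / (4 * t)) from
    funext fun y => (hasDerivAt_psiOuter_left α β y ht).deriv]
  have h : HasDerivAt (fun y : ℝ => -y ^ 2 / (4 * t)) (-(2 * x) / (4 * t)) x := by
    simpa using ((hasDerivAt_pow 2 x).neg).div_const (4 * t)
  refine (h.exp.const_mul _).congr_deriv ?_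
  field_simp
  ring

lemma eventually_psiOuter_le (α β x₀ : ℝ) {t₀ δ : ℝ} (ht₀ : 0 < t₀) (hδ : 0 < δ) :
    ∃ a b : ℝ, ∀ᶠ z in 𝓝 x₀ ×ˢ 𝓝[≤] t₀, psiOuter α β z.1 z.2 -
      (a * z.1 + (b / 2 + δ) * z.1 ^ 2 + (b - δ) * z.2) ≤
      psiOuter α β x₀ t₀ - (a * x₀ + (b / 2 + δ) * x₀ ^ 2 + (b - δ) * t₀) := by
  set G : ℝ → ℝ → ℝ := fun x t =>
    α * β / 2 * Real.exp (α ^ 2 / 4) / √t * Real.exp (-x ^ 2 / (4 * t)) * (x / (2 * t)) with hG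
  set b : ℝ := G x₀ t₀ with hb
  set ψx : ℝ := -(α * β / 2 * Real.exp (α ^ 2 / 4) / √t₀) * Real.exp (-x₀ ^ 2 / (4 * t₀))
  refine ⟨ψx - 2 * (b / 2 + δ) * x₀, b, ?_⟩
  set a := ψx - 2 * (b / 2 + δ) * x₀
  have hpoly : ∀ x, HasDerivAt (fun x : ℝ => a * x + (b / 2 + δ) * x ^ 2)
      (a + (b / 2 + δ) * (2 * x)) x := fun x => by
    simpa using ((hasDerivAt_id x).const_mul a).fun_add ((hasDerivAt_pow 2 x).const_mul (b / 2 + δ))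
  have hspace : ∀ᶠ x in 𝓝 x₀, psiOuter α β x t₀ - (a * x + (b / 2 + δ) * x ^ 2) ≤
      psiOuter α β x₀ t₀ - (a * x₀ + (b / 2 + δ) * x₀ ^ 2) := by
    have hd : (deriv fun x => psiOuter α β x t₀ - (a * x + (b / 2 + δ) * x ^ 2)) =
        fun x => deriv (fun y => psiOuter α β y t₀) x - (a + (b / 2 + δ) * (2 * x)) := by
      ext x
      have h1 := hasDerivAt_psiOuter_left α β x ht₀
      rw [(h1.fun_sub (hpoly x)).deriv, h1.deriv]
    refine isLocalMax_of_deriv_deriv_neg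
      (f := fun x => psiOuter α β x t₀ - (a * x + (b / 2 + δ) * x ^ 2)) ?_ ?_ ?_
    · rw [hd]
      have h1 : HasDerivAt (fun x : ℝ => a + (b / 2 + δ) * (2 * x)) ((b / 2 + δ) * 2) x₀ := by
        simpa using (((hasDerivAt_id x₀).const_mul 2).const_mul (b / 2 + δ)).const_add a
      have h2 := (deriv_deriv_psiOuter α β x₀ ht₀).sub h1
      have h3 : deriv (fun x => deriv (fun y => psiOuter α β y t₀) x - (a + (b / 2 + δ) * (2 * x)))
        x₀ = b - (b / 2 + δ) * 2 := h2.deriv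
      rw [h3]
      linarith
    · rw [hd]
      simp only [(hasDerivAt_psiOuter_left α β x₀ ht₀).deriv]
      simp only [a, ψx]
      ring
    · exact ((hasDerivAt_psiOuter_left α β x₀ ht₀).sub (hpoly x₀)).continuousAt
  have htime : ∀ᶠ z in 𝓝 x₀ ×ˢ 𝓝[≤] t₀, psiOuter α β z.1 z.2 - (b - δ) * z.2 ≤
      psiOuter α β z.1 t₀ - (b - δ) * t₀ := by
    have hGc : ContinuousAt (fun q : ℝ × ℝ => G q.1 q.2) (x₀, t₀) := by
      simp only [hG]
      have h1 : √t₀ ≠ 0 := (Real.sqrt_pos.2 ht₀).ne'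
      have h2 : 4 * t₀ ≠ 0 := by positivity
      have h3 : 2 * t₀ ≠ 0 := by positivity
      fun_prop (disch := assumption)
    have hev : ∀ᶠ q : ℝ × ℝ in 𝓝 (x₀, t₀), b - δ < G q.1 q.2 ∧ 0 < q.2 :=
      (hGc.eventually (lt_mem_nhds (by simp only [hb]; linarith))).and
        (continuousAt_snd.eventually (lt_mem_nhds ht₀))
    obtain ⟨ε, hε, hball⟩ := Metric.eventually_nhds_iff_ball.1 hev
    have h1 : ∀ᶠ x in 𝓝 x₀, x ∈ Metric.ball x₀ ε := Metric.ball_mem_nhds _ hε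
    have h2 : ∀ᶠ t in 𝓝[≤] t₀, t ∈ Metric.ball t₀ ε :=
      mem_nhdsWithin_of_mem_nhds (Metric.ball_mem_nhds _ hε)
    filter_upwards [h1.prod_mk (h2.and self_mem_nhdsWithin)] with z hz
    obtain ⟨hz1, hz2, hz3⟩ := hz
    have hsub : Icc z.2 t₀ ⊆ Metric.ball t₀ ε := by
      rw [Real.ball_eq_Ioo] at hz2 ⊢
      exact fun s hs => ⟨hz2.1.trans_le hs.1, by linarith [hs.2]⟩
    have hprop : ∀ s ∈ Icc z.2 t₀, b - δ < G z.1 s ∧ 0 < s := fun s hs =>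
      hball (z.1, s) (by rw [← ball_prod_same]; exact ⟨hz1, hsub hs⟩)
    have hder : ∀ s ∈ Icc z.2 t₀,
        HasDerivAt (fun s => psiOuter α β z.1 s - (b - δ) * s) (G z.1 s - (b - δ)) s := fun s hs => by
      simpa using (hasDerivAt_psiOuter_right α β z.1 (hprop s hs).2).fun_sub
        ((hasDerivAt_id s).const_mul (b - δ))
    refine monotoneOn_of_deriv_nonneg (convex_Icc z.2 t₀)
      (fun s hs => (hder s hs).continuousAt.continuousWithinAt)
      (fun s hs => (hder s (interior_subset hs)).differentiableAt.differentiableWithinAt)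
      (fun s hs => ?_) (left_mem_Icc.2 hz3) (right_mem_Icc.2 hz3) hz3
    rw [(hder s (interior_subset hs)).deriv]
    linarith [(hprop s (interior_subset hs)).1]
  filter_upwards [htime, tendsto_fst.eventually hspace] with z hz1 hz2
  linarith

/-- Subtracting `ψ` preserves viscosity subsolutions of the heat equation. -/
lemma HeatViscAt.sub_psi {α β x₀ t₀ V' : ℝ} {V : ℝ → ℝ → ℝ} (hα : 0 < α) (hβ : 0 < β)
    (hx₀ : 0 < x₀) (ht₀ : 0 < t₀) (hV' : HasDerivAt (fun x => V x t₀) V' x₀)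
    (hV : HeatViscAt V x₀ t₀) : HeatViscAt (fun x t => V x t - psi α β x t) x₀ t₀ := by
  intro c₁ c₂ c₃ hc
  have hle : ∀ᶠ z : ℝ × ℝ in 𝓝 x₀ ×ˢ 𝓝[≤] t₀, 0 < z.1 ∧ 0 < z.2 :=
    (lt_mem_nhds hx₀).prod_mk (mem_nhdsWithin_of_mem_nhds (lt_mem_nhds ht₀))
  have hcont : Tendsto (fun z : ℝ × ℝ => z.1 - α * √z.2) (𝓝 x₀ ×ˢ 𝓝[≤] t₀)
      (𝓝 (x₀ - α * √t₀)) := by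
    have h : Continuous fun z : ℝ × ℝ => z.1 - α * √z.2 := by fun_prop
    refine (h.tendsto (x₀, t₀)).mono_left ?_
    rw [nhds_prod_eq]
    exact prod_mono le_rfl nhdsWithin_le_nhds
  rcases lt_trichotomy x₀ (α * √t₀) with hlt | heq | hgt
  · refine hV c₁ c₂ c₃ ?_
    filter_upwards [hc, hle, hcont.eventually (gt_mem_nhds (sub_neg.2 hlt))] with z hz hz0 hz1
    rw [psi_of_le hz0.2 (by rw [abs_of_pos hz0.1]; linarith),
      psi_of_le ht₀ (by rw [abs_of_pos hx₀]; exact hlt.le)] at hz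
    linarith
  · exfalso
    have hslice : ∀ᶠ x in 𝓝 x₀, V x t₀ - psi α β x t₀ - (c₁ * x + c₂ * x ^ 2 + c₃ * t₀) ≤
        V x₀ t₀ - psi α β x₀ t₀ - (c₁ * x₀ + c₂ * x₀ ^ 2 + c₃ * t₀) := by
      have : Tendsto (fun x => (x, t₀)) (𝓝 x₀) (𝓝 x₀ ×ˢ 𝓝[≤] t₀) :=
        tendsto_id.prodMk (tendsto_const_pure.mono_right (pure_le_nhdsWithin self_mem_Iic))
      exact this.eventually hc
    have hg : HasDerivAt (fun x => V x t₀ - (c₁ * x + c₂ * x ^ 2)) (V' - (c₁ + c₂ * (2 * x₀))) x₀ := by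
      have := ((hasDerivAt_id x₀).const_mul c₁).fun_add ((hasDerivAt_pow 2 x₀).const_mul c₂)
      exact hV'.fun_sub (by simpa using this)
    have h1 : 0 ≤ V' - (c₁ + c₂ * (2 * x₀)) := by
      refine hg.nonneg_of_eventually_left_le ?_
      filter_upwards [mem_nhdsWithin_of_mem_nhds hslice, self_mem_nhdsWithin,
        mem_nhdsWithin_of_mem_nhds (lt_mem_nhds hx₀)] with x hx hxl hx0
      rw [psi_of_le ht₀ (by rw [abs_of_pos hx0, ← heq]; exact le_of_lt hxl),
        psi_of_le ht₀ (by rw [abs_of_pos hx₀, ← heq])] at hx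
      linarith
    have h2 := (hg.sub (hasDerivAt_psiOuter_left α β x₀ ht₀)).nonpos_of_eventually_right_le (by
      filter_upwards [mem_nhdsWithin_of_mem_nhds hslice, self_mem_nhdsWithin] with x hx hxr
      rw [psi_of_ge hα ht₀ (by rw [← heq]; exact le_of_lt hxr),
        psi_of_ge hα ht₀ heq.symm.le] at hx
      simp only [Pi.sub_apply]
      linarith)
    have h3 : 0 < α * β / 2 * Real.exp (α ^ 2 / 4) / √t₀ * Real.exp (-x₀ ^ 2 / (4 * t₀)) := by
      positivity
    linarith
  · refine le_of_forall_pos_le_add fun ε hε => ?_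
    obtain ⟨a, b, hab⟩ := eventually_psiOuter_le α β x₀ ht₀ (δ := ε / 3) (by positivity)
    have := hV (c₁ + a) (c₂ + (b / 2 + ε / 3)) (c₃ + (b - ε / 3)) (by
      filter_upwards [hc, hab, hle, hcont.eventually (lt_mem_nhds (sub_pos.2 hgt))]
        with z hz hz1 hz0 hz2
      rw [psi_of_ge hα hz0.2 (by linarith), psi_of_ge hα ht₀ hgt.le] at hz
      linarith)
    linarith

/-- `v` is continuous and solves `v_t = v_xx - f` on the open half-line `x > 0` in integrated
form, tested against time-independent functions. -/
structure HeatWeak (v f : ℝ → ℝ → ℝ) : Prop where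
  cont : ContinuousOn (fun q : ℝ × ℝ => v q.1 q.2) (univ ×ˢ Ici 0)
  slice : ∀ ξ : ℝ → ℝ, ContDiff ℝ ∞ ξ → HasCompactSupport ξ → tsupport ξ ⊆ Ioi 0 → ∀ T > (0:ℝ),
    ∀ᵐ τ ∂(volume.restrict (Ioc 0 T)), Integrable fun x => f x τ * ξ x
  integrable : ∀ ξ : ℝ → ℝ, ContDiff ℝ ∞ ξ → HasCompactSupport ξ → tsupport ξ ⊆ Ioi 0 →
    ∀ T > (0:ℝ), IntervalIntegrable (fun τ => ∫ x, f x τ * ξ x) volume 0 T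
  eq : ∀ ξ : ℝ → ℝ, ContDiff ℝ ∞ ξ → HasCompactSupport ξ → tsupport ξ ⊆ Ioi 0 →
    ∀ s t : ℝ, 0 ≤ s → s ≤ t → (∫ x, ξ x * v x t) - ∫ x, ξ x * v x s =
      (∫ τ in s..t, ∫ x, deriv (deriv ξ) x * v x τ) - ∫ τ in s..t, ∫ x, f x τ * ξ x

lemma ContDiff.deriv_deriv {ξ : ℝ → ℝ} (hξ : ContDiff ℝ ∞ ξ) : ContDiff ℝ ∞ (deriv (deriv ξ)) :=
  ((contDiff_infty_iff_deriv).1 ((contDiff_infty_iff_deriv).1 hξ).2).2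

namespace HeatWeak

variable {v f v₁ f₁ v₂ f₂ : ℝ → ℝ → ℝ}

lemma neg (h : HeatWeak v f) : HeatWeak (fun x t => -v x t) (fun x t => -f x t) where
  cont := h.cont.neg
  slice ξ h1 h2 h3 T hT := by
    filter_upwards [h.slice ξ h1 h2 h3 T hT] with τ hτ
    simp only [neg_mul]
    exact hτ.neg
  integrable ξ h1 h2 h3 T hT := by
    simp only [neg_mul, integral_neg]
    exact (h.integrable ξ h1 h2 h3 T hT).neg
  eq ξ h1 h2 h3 s t hs hst := by
    simp only [neg_mul, mul_neg, integral_neg, intervalIntegral.integral_neg]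
    linarith [h.eq ξ h1 h2 h3 s t hs hst]

lemma intervalIntegrable (hv : HeatWeak v f) {ξ : ℝ → ℝ} (h1 : ContDiff ℝ ∞ ξ)
    (h2 : HasCompactSupport ξ) (h3 : tsupport ξ ⊆ Ioi 0) {s t : ℝ} (hs : 0 ≤ s) (hst : s ≤ t) :
    IntervalIntegrable (fun τ => ∫ x, f x τ * ξ x) volume s t := by
  refine (hv.integrable ξ h1 h2 h3 (t + 1) (by linarith)).mono_set ?_
  rw [uIcc_of_le hst, uIcc_of_le (by linarith)]
  exact Icc_subset_Icc hs (by linarith)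

lemma comp_add_right (hv : HeatWeak v f) {h : ℝ} (hh : 0 ≤ h) :
    HeatWeak (fun x t => v x (t + h)) (fun x t => f x (t + h)) where
  cont := hv.cont.comp (f := fun q : ℝ × ℝ => (q.1, q.2 + h)) (by fun_prop)
    fun q hq => ⟨mem_univ _, add_nonneg hq.2 hh⟩
  slice ξ h1 h2 h3 T hT := by
    have := (ae_restrict_iff' measurableSet_Ioc).1 (hv.slice ξ h1 h2 h3 (T + h) (by linarith))
    rw [ae_restrict_iff' measurableSet_Ioc]
    filter_upwards [(quasiMeasurePreserving_add_right volume h).ae this] with τ hτ hmem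
    exact hτ ⟨by linarith [hmem.1], by linarith [hmem.2]⟩
  integrable ξ h1 h2 h3 T hT := by
    have := (hv.intervalIntegrable h1 h2 h3 hh (by linarith : h ≤ T + h)).comp_add_right h
    simpa using this
  eq ξ h1 h2 h3 s t hs hst := by
    rw [hv.eq ξ h1 h2 h3 (s + h) (t + h) (by linarith) (by linarith)]
    rw [intervalIntegral.integral_comp_add_right (fun τ => ∫ x, deriv (deriv ξ) x * v x τ),
      intervalIntegral.integral_comp_add_right (fun τ => ∫ x, f x τ * ξ x)]

lemma integrable_mul (hv : HeatWeak v f) {ξ : ℝ → ℝ} (hξ : Continuous ξ)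
    (hc : HasCompactSupport ξ) {t : ℝ} (ht : 0 ≤ t) : Integrable fun x => ξ x * v x t :=
  (hξ.mul (hv.cont.comp_continuous (by fun_prop : Continuous fun x : ℝ => (x, t))
    fun x => ⟨mem_univ _, ht⟩)).integrable_of_hasCompactSupport hc.mul_right

lemma intervalIntegrable_mul (hv : HeatWeak v f) {ξ : ℝ → ℝ} (hξ : Continuous ξ)
    (hc : HasCompactSupport ξ) {s t : ℝ} (hs : 0 ≤ s) (hst : s ≤ t) :
    IntervalIntegrable (fun τ => ∫ x, ξ x * v x τ) volume s t := by
  refine ((continuousOn_integral_mul_slice hv.cont hξ hc).mono ?_).intervalIntegrable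
  rw [uIcc_of_le hst]
  exact fun τ hτ => hs.trans hτ.1

lemma add (hv₁ : HeatWeak v₁ f₁) (hv₂ : HeatWeak v₂ f₂) :
    HeatWeak (fun x t => v₁ x t + v₂ x t) (fun x t => f₁ x t + f₂ x t) where
  cont := hv₁.cont.add hv₂.cont
  slice ξ h1 h2 h3 T hT := by
    filter_upwards [hv₁.slice ξ h1 h2 h3 T hT, hv₂.slice ξ h1 h2 h3 T hT] with τ hτ₁ hτ₂
    simp only [add_mul]
    exact hτ₁.add hτ₂
  integrable ξ h1 h2 h3 T hT := by
    refine ((hv₁.integrable ξ h1 h2 h3 T hT).add (hv₂.integrable ξ h1 h2 h3 T hT)).congr_ae ?_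
    rw [uIoc_of_le hT.le]
    filter_upwards [hv₁.slice ξ h1 h2 h3 T hT, hv₂.slice ξ h1 h2 h3 T hT] with τ hτ₁ hτ₂
    simp only [add_mul]
    exact (integral_add hτ₁ hτ₂).symm
  eq ξ h1 h2 h3 s t hs hst := by
    have ht := hs.trans hst
    have hξ'' := h1.deriv_deriv.continuous
    have hc'' : HasCompactSupport (deriv (deriv ξ)) := h2.deriv.deriv
    have hJ : ∫ τ in s..t, ∫ x, deriv (deriv ξ) x * (v₁ x τ + v₂ x τ) =
        (∫ τ in s..t, ∫ x, deriv (deriv ξ) x * v₁ x τ) +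
          ∫ τ in s..t, ∫ x, deriv (deriv ξ) x * v₂ x τ := by
      rw [← intervalIntegral.integral_add (hv₁.intervalIntegrable_mul hξ'' hc'' hs hst)
        (hv₂.intervalIntegrable_mul hξ'' hc'' hs hst)]
      refine intervalIntegral.integral_congr fun τ hτ => ?_
      rw [uIcc_of_le hst] at hτ
      have hτ0 := hs.trans hτ.1
      simp only [mul_add]
      exact integral_add (hv₁.integrable_mul hξ'' hc'' hτ0) (hv₂.integrable_mul hξ'' hc'' hτ0)
    have hN : ∫ τ in s..t, ∫ x, (f₁ x τ + f₂ x τ) * ξ x =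
        (∫ τ in s..t, ∫ x, f₁ x τ * ξ x) + ∫ τ in s..t, ∫ x, f₂ x τ * ξ x := by
      rw [← intervalIntegral.integral_add (hv₁.intervalIntegrable h1 h2 h3 hs hst)
        (hv₂.intervalIntegrable h1 h2 h3 hs hst)]
      refine intervalIntegral.integral_congr_ae ?_
      filter_upwards [(ae_restrict_iff' measurableSet_Ioc).1
          (hv₁.slice ξ h1 h2 h3 (t + 1) (by linarith)),
        (ae_restrict_iff' measurableSet_Ioc).1
          (hv₂.slice ξ h1 h2 h3 (t + 1) (by linarith))] with τ hτ₁ hτ₂ hmem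
      rw [uIoc_of_le hst] at hmem
      have hm : τ ∈ Ioc 0 (t + 1) := ⟨hs.trans_lt hmem.1, by linarith [hmem.2]⟩
      simp only [add_mul]
      exact integral_add (hτ₁ hm) (hτ₂ hm)
    have hsplit : ∀ τ ≥ 0, ∫ x, ξ x * (v₁ x τ + v₂ x τ) =
        (∫ x, ξ x * v₁ x τ) + ∫ x, ξ x * v₂ x τ := fun τ hτ => by
      simp only [mul_add]
      exact integral_add (hv₁.integrable_mul h1.continuous h2 hτ)
        (hv₂.integrable_mul h1.continuous h2 hτ)
    rw [hJ, hN, hsplit t ht, hsplit s hs]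
    linarith [hv₁.eq ξ h1 h2 h3 s t hs hst, hv₂.eq ξ h1 h2 h3 s t hs hst]

lemma heatViscAt (hv : HeatWeak v f) {x₀ t₀ : ℝ} (hx₀ : 0 < x₀) (ht₀ : 0 < t₀)
    (hf : ∀ᶠ q : ℝ × ℝ in 𝓝 (x₀, t₀), 0 ≤ f q.1 q.2) : HeatViscAt v x₀ t₀ := by
  obtain ⟨ε, hε, hball⟩ := Metric.eventually_nhds_iff_ball.1 hf
  set r := min ε (min x₀ t₀) / 2 with hr_def
  have hm : 0 < min ε (min x₀ t₀) := lt_min hε (lt_min hx₀ ht₀)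
  have hr : 0 < r := by positivity
  have hrε : r < ε := by linarith [min_le_left ε (min x₀ t₀)]
  have hrx : r < x₀ := by linarith [(min_le_right ε (min x₀ t₀)).trans (min_le_left _ _)]
  have hrt : r < t₀ := by linarith [(min_le_right ε (min x₀ t₀)).trans (min_le_right _ _)]
  refine heatViscAt_of_weak hr ?_ ?_
  · exact hv.cont.mono fun q hq => ⟨mem_univ _, show (0:ℝ) ≤ q.2 by linarith [hq.2.1]⟩
  · intro ξ h1 h2 h3 h4 s t hs hst ht
    have h3' : tsupport ξ ⊆ Ioi 0 := fun x hx => show (0:ℝ) < x by linarith [(h3 hx).1]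
    rw [hv.eq ξ h1 h2 h3' s t (by linarith) hst]
    refine sub_le_self _ (intervalIntegral.integral_nonneg hst fun τ hτ =>
      integral_nonneg fun x => ?_)
    by_cases hx : x ∈ tsupport ξ
    · refine mul_nonneg (hball (x, τ) ?_) (h4 x)
      rw [← ball_prod_same, Real.ball_eq_Ioo, Real.ball_eq_Ioo]
      have := h3 hx
      exact ⟨⟨by linarith [this.1], by linarith [this.2]⟩,
        ⟨by linarith [hτ.1], by linarith [hτ.2]⟩⟩
    · simp [image_eq_zero_of_notMem_tsupport hx]

end HeatWeak

lemma eq_zero_of_forall_integral_mul_eq_zero {g : ℝ → ℝ} (hg : Continuous g)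
    (h : ∀ ξ : ℝ → ℝ, ContDiff ℝ ∞ ξ → HasCompactSupport ξ → tsupport ξ ⊆ Ioi 0 →
      ∫ x, ξ x * g x = 0) : ∀ x ≥ 0, g x = 0 := by
  have hae := isOpen_Ioi.ae_eq_zero_of_integral_contDiff_smul_eq_zero (U := Ioi (0:ℝ))
    (μ := volume) (f := g) (hg.locallyIntegrable.locallyIntegrableOn _) fun ξ h1 h2 h3 => by
      simpa using h ξ h1 h2 h3
  have heq : EqOn g 0 (Ioi 0) := by
    refine Measure.eqOn_open_of_ae_eq (μ := volume) ?_ isOpen_Ioi hg.continuousOn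
      continuousOn_const
    rw [EventuallyEq, ae_restrict_iff' measurableSet_Ioi]
    exact hae
  intro x hx
  have : EqOn g 0 (closure (Ioi 0)) := heq.closure hg continuous_const
  rw [closure_Ioi] at this
  exact this hx

lemma IsAdmissible.integrableOn_mul {α β : ℝ} {p u w : ℝ → ℝ → ℝ} (hp : IsAdmissible p)
    (hα : 0 < α) (hβ : 0 < β) (hu : AuxReg α β u w) {ξ : ℝ → ℝ} (hξ : Continuous ξ)
    (hξc : HasCompactSupport ξ) (hξs : tsupport ξ ⊆ Ioi 0) {T : ℝ} (hT : 0 < T) :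
    IntegrableOn (fun q : ℝ × ℝ => p q.1 q.2 * u q.1 q.2 * ξ q.1) (univ ×ˢ Ioc 0 T) := by
  obtain ⟨-, hcont, -, hbd⟩ := hu
  obtain ⟨C, hC⟩ := hbd T hT
  obtain ⟨M, hM⟩ := hξc.exists_bound_of_continuous hξ
  have hK : IsCompact (tsupport ξ ×ˢ Icc 0 T) := hξc.prod isCompact_Icc
  have hpK : IntegrableOn (fun q : ℝ × ℝ => p q.1 q.2) (tsupport ξ ×ˢ Ioc 0 T) :=
    (hp.2.1.integrableOn_compact_subset (prod_mono hξs Icc_subset_Ici_self) hK).mono_set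
      (prod_mono_right Ioc_subset_Icc_self)
  have hmeas : MeasurableSet (tsupport ξ ×ˢ Ioc 0 T) :=
    (isClosed_tsupport ξ).measurableSet.prod measurableSet_Ioc
  have huc : ContinuousOn (fun q : ℝ × ℝ => u q.1 q.2) (tsupport ξ ×ˢ Ioc 0 T) := by
    have h1 := hcont.mono
      (prod_mono (subset_univ (tsupport ξ)) (fun t ht => ht.1.le : Ioc 0 T ⊆ Ici 0))
    have h2 := (continuousOn_psi α β).mono
      (prod_mono (subset_univ (tsupport ξ)) (fun t ht => ht.1 : Ioc 0 T ⊆ Ioi 0))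
    exact (h1.add h2).congr fun q _ => by simp
  have huξ : IntegrableOn (fun q : ℝ × ℝ => (u q.1 q.2 * ξ q.1) * p q.1 q.2)
      (tsupport ξ ×ˢ Ioc 0 T) := by
    refine hpK.bdd_mul (c := (C + PsiP α β 0) * M) ?_ ?_
    · exact (huc.mul (by fun_prop)).aestronglyMeasurable hmeas
    · filter_upwards [ae_restrict_mem hmeas] with q hq
      rw [norm_mul]
      have h1 : ‖u q.1 q.2‖ ≤ C + PsiP α β 0 := by
        calc ‖u q.1 q.2‖ = ‖(u q.1 q.2 - psi α β q.1 q.2) + psi α β q.1 q.2‖ := by simp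
          _ ≤ ‖u q.1 q.2 - psi α β q.1 q.2‖ + ‖psi α β q.1 q.2‖ := norm_add_le _ _
          _ ≤ C + PsiP α β 0 := by
            refine add_le_add (hC q.1 q.2 (Ioc_subset_Icc_self hq.2)).1 ?_
            rw [Real.norm_of_nonneg (psi_nonneg hα hβ _ _)]
            exact psi_le hα hβ _ _
      exact mul_le_mul h1 (hM _) (norm_nonneg _) ((norm_nonneg _).trans h1)
  refine (huξ.congr_fun (g := fun q : ℝ × ℝ => p q.1 q.2 * u q.1 q.2 * ξ q.1)
    (fun q _ => by ring) hmeas).of_forall_sdiff_eq_zero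
    (MeasurableSet.univ.prod measurableSet_Ioc) fun q hq => ?_
  have : q.1 ∉ tsupport ξ := fun h => hq.2 ⟨h, hq.1.2⟩
  simp [image_eq_zero_of_notMem_tsupport this]

lemma WeakForm.integrated {α β : ℝ} {p u w : ℝ → ℝ → ℝ} (hα : 0 < α) (hβ : 0 < β)
    (hp : IsAdmissible p) (hu : AuxReg α β u w) (hw : WeakForm α β u p w) {ξ : ℝ → ℝ}
    (h1 : ContDiff ℝ ∞ ξ) (h2 : HasCompactSupport ξ) (h3 : tsupport ξ ⊆ Ioi 0) {T : ℝ}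
    (hT : 0 < T) :
    (∀ᵐ τ ∂(volume.restrict (Ioc 0 T)), Integrable fun x => p x τ * u x τ * ξ x) ∧
    IntervalIntegrable (fun τ => ∫ x, p x τ * u x τ * ξ x) volume 0 T ∧
    ∀ t ∈ Icc 0 T, ∫ x, ξ x * (u x t - psi α β x t) =
      (∫ τ in 0..t, ∫ x, deriv (deriv ξ) x * (u x τ - psi α β x τ)) -
        ∫ τ in 0..t, ∫ x, p x τ * u x τ * ξ x :=
  weak_integrated_in_time (v := fun x t => u x t - psi α β x t)
    (f := fun x t => p x t * u x t) hT hu.2.1 hu.2.2.1 hu.1 (hw T hT) h1 h2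
    (hp.integrableOn_mul hα hβ hu h1.continuous h2 h3 hT)

lemma WeakForm.heatWeak {α β : ℝ} {p u w : ℝ → ℝ → ℝ} (hα : 0 < α) (hβ : 0 < β)
    (hp : IsAdmissible p) (hu : AuxReg α β u w) (hw : WeakForm α β u p w) :
    HeatWeak (fun x t => u x t - psi α β x t) (fun x t => p x t * u x t) where
  cont := hu.2.1
  slice _ h1 h2 h3 _ hT := (hw.integrated hα hβ hp hu h1 h2 h3 hT).1
  integrable _ h1 h2 h3 _ hT := (hw.integrated hα hβ hp hu h1 h2 h3 hT).2.1
  eq ξ h1 h2 h3 s t hs hst := by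
    have ht := hs.trans hst
    obtain ⟨-, hN, h⟩ := hw.integrated hα hβ hp hu h1 h2 h3 (T := t + 1) (by linarith)
    have hsub : ∀ a b : ℝ, 0 ≤ a → a ≤ b → b ≤ t + 1 → uIcc a b ⊆ uIcc 0 (t + 1) :=
      fun a b ha hab hb => by
        rw [uIcc_of_le hab, uIcc_of_le (by linarith)]
        exact Icc_subset_Icc ha hb
    have hJ : ContinuousOn (fun τ => ∫ x, deriv (deriv ξ) x * (u x τ - psi α β x τ)) (Ici 0) :=
      continuousOn_integral_mul_slice hu.2.1 h1.deriv_deriv.continuous h2.deriv.deriv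
    have hJ' : ∀ a b : ℝ, 0 ≤ a → a ≤ b → IntervalIntegrable
        (fun τ => ∫ x, deriv (deriv ξ) x * (u x τ - psi α β x τ)) volume a b := fun a b ha hab =>
      (hJ.mono (by rw [uIcc_of_le hab]; exact fun τ hτ => ha.trans hτ.1)).intervalIntegrable
    rw [h t ⟨ht, by linarith⟩, h s ⟨hs, by linarith⟩,
      ← intervalIntegral.integral_add_adjacent_intervals (hJ' 0 s le_rfl hs) (hJ' s t hs hst),
      ← intervalIntegral.integral_add_adjacent_intervals
        (hN.mono_set (hsub 0 s le_rfl hs (by linarith)))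
        (hN.mono_set (hsub s t hs hst (by linarith)))]
    ring

lemma WeakForm.initial {α β : ℝ} {p u w : ℝ → ℝ → ℝ} (hα : 0 < α) (hβ : 0 < β)
    (hp : IsAdmissible p) (hu : AuxReg α β u w) (hw : WeakForm α β u p w) :
    ∀ x ≥ 0, u x 0 - psi α β x 0 = 0 := by
  refine eq_zero_of_forall_integral_mul_eq_zero (g := fun x => u x 0 - psi α β x 0) ?_ ?_
  · exact hu.2.1.comp_continuous (by fun_prop : Continuous fun x : ℝ => (x, (0:ℝ)))
      fun x => ⟨mem_univ _, self_mem_Ici⟩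
  · intro ξ h1 h2 h3
    simpa using (hw.integrated hα hβ hp hu h1 h2 h3 one_pos).2.2 0 ⟨le_rfl, zero_le_one⟩

lemma HasDerivAt.eq_zero_of_even {g : ℝ → ℝ} {g' : ℝ} (h : HasDerivAt g g' 0)
    (heven : ∀ x, g (-x) = g x) : g' = 0 := by
  have h1 : HasDerivAt (fun x => g (-x)) (-g') 0 := by
    have h0 : HasDerivAt g g' (-0) := by simpa using h
    exact (h0.comp (0:ℝ) (hasDerivAt_neg (0:ℝ))).congr_deriv (by ring)
  simp only [heven] at h1
  linarith [h1.unique h]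

section

variable {α β : ℝ} {p u w : ℝ → ℝ → ℝ}

lemma AuxReg.hasDerivAt_zero (hu : AuxReg α β u w) (heven : ∀ x t, u (-x) t = u x t) {t : ℝ}
    (ht : 0 ≤ t) : HasDerivAt (fun x => u x t - psi α β x t) 0 0 := by
  have h := hu.1 t ht 0
  rwa [h.eq_zero_of_even fun x => by rw [heven, psi_neg_left]] at h

lemma AuxReg.continuousAt_sub_psi (hu : AuxReg α β u w) (x : ℝ) {t : ℝ} (ht : 0 < t) :
    ContinuousAt (fun q : ℝ × ℝ => u q.1 q.2 - psi α β q.1 q.2) (x, t) :=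
  hu.2.1.continuousAt (prod_mem_nhds univ_mem (Ici_mem_nhds ht))

lemma AuxReg.continuousAt (hu : AuxReg α β u w) (x : ℝ) {t : ℝ} (ht : 0 < t) :
    ContinuousAt (fun q : ℝ × ℝ => u q.1 q.2) (x, t) := by
  have h1 := (continuousOn_psi α β).continuousAt
    (prod_mem_nhds univ_mem (Ioi_mem_nhds ht) : univ ×ˢ Ioi 0 ∈ 𝓝 (x, t))
  simpa using (hu.continuousAt_sub_psi x ht).fun_add h1

lemma AuxReg.upperSemicontinuousOn_neg (hu : AuxReg α β u w) (hα : 0 < α) (hβ : 0 < β) (T : ℝ) :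
    UpperSemicontinuousOn (fun q : ℝ × ℝ => -(u q.1 q.2 - psi α β q.1 q.2) - psi α β q.1 q.2)
      (Ici 0 ×ˢ Icc 0 T) := by
  rintro ⟨x, t⟩ ⟨hx, ht⟩
  rcases ht.1.eq_or_lt with h0 | h0
  · have hc := (hu.2.1 (x, t) ⟨mem_univ _, ht.1⟩).mono
      (prod_mono (subset_univ (Ici 0)) (Icc_subset_Ici_self : Icc 0 T ⊆ Ici 0))
    intro y hy
    simp only [psi_of_nonpos α β x h0.symm.le, sub_zero] at hy
    have hy' : -(u x t - psi α β x t) < y := by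
      rw [psi_of_nonpos α β x h0.symm.le, sub_zero]; exact hy
    filter_upwards [hc.neg.eventually (gt_mem_nhds hy')] with q hq
    have hq' : -(u q.1 q.2 - psi α β q.1 q.2) < y := hq
    linarith [psi_nonneg hα hβ q.1 q.2]
  · have : ContinuousAt
        (fun q : ℝ × ℝ => -(u q.1 q.2 - psi α β q.1 q.2) - psi α β q.1 q.2) (x, t) := by
      simpa using (hu.continuousAt x h0).fun_neg
    exact this.continuousWithinAt.upperSemicontinuousWithinAt

lemma WeakForm.u_nonneg (hα : 0 < α) (hβ : 0 < β) (hp : IsAdmissible p)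
    (hnn : ∀ x t : ℝ, 0 ≤ p x t) (heven : ∀ x t, u (-x) t = u x t) (hu : AuxReg α β u w)
    (hw : WeakForm α β u p w) {x t : ℝ} (hx : 0 ≤ x) (ht : 0 ≤ t) : 0 ≤ u x t := by
  obtain ⟨C, hC⟩ := hu.2.2.2 (t + 1) (by linarith)
  have key := nonpos_of_heatViscAt
    (D := fun x t => -(u x t - psi α β x t) - psi α β x t) (T := t + 1) (C := C)
    (hu.upperSemicontinuousOn_neg hα hβ _) ?_ ?_ ?_ ?_ x hx t ⟨ht, by linarith⟩
  · linarith
  · intro x _ t ht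
    linarith [neg_le_of_abs_le (hC x t ht).1, psi_nonneg hα hβ x t]
  · intro x hx
    linarith [hw.initial hα hβ hp hu x hx, psi_nonneg hα hβ x 0]
  · intro t ht
    have h1 := (hu.hasDerivAt_zero heven ht.1.le).fun_neg
    have h2 : HasDerivAt (fun x => psi α β x t) 0 0 := by
      refine (hasDerivAt_const (0:ℝ) (PsiP α β α)).congr_of_eventuallyEq ?_
      have h3 : 0 < α * √t := mul_pos hα (Real.sqrt_pos.2 ht.1)
      filter_upwards [Ioo_mem_nhds (neg_neg_of_pos h3) h3] with x hx
      exact psi_of_le ht.1 (abs_le.2 ⟨hx.1.le, hx.2.le⟩)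
    simpa using h1.fun_sub h2
  · intro x hx t ht hpos
    have hneg : u x t < 0 := by simpa using hpos
    refine HeatViscAt.sub_psi hα hβ hx ht.1 (hu.1 t ht.1.le x).fun_neg ?_
    refine (hw.heatWeak hα hβ hp hu).neg.heatViscAt hx ht.1 ?_
    filter_upwards [(hu.continuousAt x ht.1).eventually (gt_mem_nhds hneg)] with q hq
    exact neg_nonneg.2 (mul_nonpos_of_nonneg_of_nonpos (hnn _ _) (le_of_lt hq))

lemma WeakForm.u_sub_psi_nonpos (hα : 0 < α) (hβ : 0 < β) (hp : IsAdmissible p)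
    (hnn : ∀ x t : ℝ, 0 ≤ p x t) (heven : ∀ x t, u (-x) t = u x t) (hu : AuxReg α β u w)
    (hw : WeakForm α β u p w) {x t : ℝ} (hx : 0 ≤ x) (ht : 0 ≤ t) :
    u x t - psi α β x t ≤ 0 := by
  obtain ⟨C, hC⟩ := hu.2.2.2 (t + 1) (by linarith)
  refine nonpos_of_heatViscAt (D := fun x t => u x t - psi α β x t) (T := t + 1) (C := C)
    (hu.2.1.mono (prod_mono (subset_univ _) Icc_subset_Ici_self)).upperSemicontinuousOn
    (fun x _ t ht => (le_abs_self _).trans (hC x t ht).1)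
    (fun x hx => (hw.initial hα hβ hp hu x hx).le)
    (fun t ht => hu.hasDerivAt_zero heven ht.1.le) ?_ x hx t ⟨ht, by linarith⟩
  intro x hx t ht _
  refine (hw.heatWeak hα hβ hp hu).heatViscAt hx ht.1 ?_
  filter_upwards [prod_mem_nhds (Ioi_mem_nhds hx) (Ioi_mem_nhds ht.1)] with q hq
  exact mul_nonneg (hnn _ _) (hw.u_nonneg hα hβ hp hnn heven hu (le_of_lt hq.1) (le_of_lt hq.2))

lemma WeakForm.u_sub_psi_add_le (hα : 0 < α) (hβ : 0 < β) (hp : IsAdmissible p)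
    (hnn : ∀ x t : ℝ, 0 ≤ p x t) (hmono : ∀ x : ℝ, MonotoneOn (fun t => p x t) (Ici (0:ℝ)))
    (heven : ∀ x t, u (-x) t = u x t) (hu : AuxReg α β u w)
    (hw : WeakForm α β u p w) {x t h : ℝ} (hx : 0 ≤ x) (ht : 0 ≤ t) (hh : 0 ≤ h) :
    u x (t + h) - psi α β x (t + h) ≤ u x t - psi α β x t := by
  have hv := hw.heatWeak hα hβ hp hu
  have hD := (hv.comp_add_right hh).add hv.neg
  obtain ⟨C, hC⟩ := hu.2.2.2 (t + 1 + h) (by linarith)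
  have key := nonpos_of_heatViscAt (T := t + 1) (C := C + C)
    (D := fun x t => u x (t + h) - psi α β x (t + h) + -(u x t - psi α β x t))
    (hD.cont.mono (prod_mono (subset_univ _) Icc_subset_Ici_self)).upperSemicontinuousOn
    ?_ ?_ ?_ ?_ x hx t ⟨ht, by linarith⟩
  · linarith
  · intro x _ t ht
    have h1 := (le_abs_self _).trans (hC x (t + h) ⟨by linarith [ht.1], by linarith [ht.2]⟩).1
    have h2 := neg_le_of_abs_le (hC x t ⟨ht.1, by linarith [ht.2]⟩).1
    linarith
  · intro x hx
    rw [hw.initial hα hβ hp hu x hx, neg_zero, add_zero]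
    exact hw.u_sub_psi_nonpos hα hβ hp hnn heven hu hx (by linarith)
  · intro t ht
    simpa using (hu.hasDerivAt_zero heven (add_nonneg ht.1.le hh)).fun_add
      (hu.hasDerivAt_zero heven ht.1.le).fun_neg
  · intro x hx t ht hpos
    refine hD.heatViscAt hx ht.1 ?_
    have hDc := hD.cont.continuousAt (x := (x, t)) (prod_mem_nhds univ_mem (Ici_mem_nhds ht.1))
    filter_upwards [hDc.eventually (lt_mem_nhds hpos),
      prod_mem_nhds (Ioi_mem_nhds hx) (Ioi_mem_nhds ht.1)] with q hq hq0
    obtain ⟨hq1, hq2⟩ : 0 < q.1 ∧ 0 < q.2 := hq0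
    have hψ : psi α β q.1 q.2 ≤ psi α β q.1 (q.2 + h) := psi_mono_right hα hβ q.1 (by linarith)
    have hu0 := hw.u_nonneg hα hβ hp hnn heven hu hq1.le hq2.le
    have hpm : p q.1 q.2 ≤ p q.1 (q.2 + h) :=
      hmono q.1 hq2.le (add_nonneg hq2.le hh) (by linarith)
    have := mul_le_mul hpm (by linarith : u q.1 q.2 ≤ u q.1 (q.2 + h)) hu0 (hnn _ _)
    linarith

end

/-- for an admissible precipitation function that is non-negative and
non-decreasing in time, `u - ψ` is non-increasing in time for every fixed `x`. -/
theorem aux_u_sub_psi_antitone (α β : ℝ) (hα : 0 < α) (hβ : 0 < β)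
    (p : ℝ → ℝ → ℝ) (hadm : IsAdmissible p)
    (hnn : ∀ x t : ℝ, 0 ≤ p x t)
    (hmono : ∀ x : ℝ, MonotoneOn (fun t => p x t) (Set.Ici (0:ℝ)))
    (u : ℝ → ℝ → ℝ) (hsol : IsAuxSolution α β p u) :
    ∀ x : ℝ, AntitoneOn (fun t => u x t - psi α β x t) (Set.Ici 0) := by
  obtain ⟨heven, w, hu, hw⟩ := hsol
  have key : ∀ x ≥ 0, AntitoneOn (fun t => u x t - psi α β x t) (Ici 0) := by
    intro x hx s hs t ht hst
    have := hw.u_sub_psi_add_le hα hβ hadm hnn hmono heven hu hx hs (sub_nonneg.2 hst)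
    simpa using this
  intro x
  rcases le_total 0 x with hx | hx
  · exact key x hx
  · have := key (-x) (neg_nonneg.2 hx)
    simpa only [heven, psi_neg_left] using this

end
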